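/- Let n ≥ 1, let 0 < p < q < ∞ with n(1/p − 1/q) > 1, and let g be a holomorphic function on B_n. Then J_g is bounded from H^p to H^q (i.e. there exists C > 0 with ‖J_g f‖_{H^q} ≤ C‖f‖_{H^p} for every f ∈ H^p) if and only if g is constant, in which case J_g ≡ 0. -/

import Mathlib

open MeasureTheory Metric Set Filter
open scoped ENNReal NNReal Topology

noncomputable section

/-- ℂⁿ with its Euclidean (Hermitian) structure. -/
abbrev En (n : ℕ) := EuclideanSpace ℂ (Fin n)

instance (n : ℕ) : MeasurableSpace (En n) := borel _
instance (n : ℕ) : BorelSpace (En n) := ⟨rfl⟩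

/-- The open unit ball `B_n` of ℂⁿ. -/
def Bn (n : ℕ) : Set (En n) := Metric.ball 0 1

/-- The unit sphere `S_n = ∂B_n`. -/
def Sn (n : ℕ) : Set (En n) := Metric.sphere 0 1

/-- The Hermitian inner product `⟨z,w⟩ = ∑ z_k * conj (w_k)`. -/
def herm {n : ℕ} (z w : En n) : ℂ := ∑ k, z k * (starRingEnd ℂ) (w k)

/-- The surface measure on the unit sphere, normalized so that `σ(S_n) = 1`
(the `(2n-1)`-dimensional Hausdorff measure restricted to the sphere, normalized). -/
def sigmaS (n : ℕ) : Measure (En n) :=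
  ((μH[(2 * n - 1 : ℝ)] (Sn n))⁻¹) • (μH[(2 * n - 1 : ℝ)]).restrict (Sn n)

/-- Lebesgue measure on the unit ball, normalized so that `v(B_n) = 1`. -/
def volN (n : ℕ) : Measure (En n) :=
  ((volume (Bn n))⁻¹) • volume.restrict (Bn n)

/-- The radial derivative `Rg(z) = ∑ z_k ∂g/∂z_k (z) = (Dg)(z)[z]`. -/
def radD {n : ℕ} (g : En n → ℂ) (z : En n) : ℂ := fderiv ℂ g z z

/-- The Volterra-type integration operator `J_g f(z) = ∫₀¹ f(tz) Rg(tz) dt/t`. -/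
def J {n : ℕ} (g f : En n → ℂ) (z : En n) : ℂ :=
  ∫ t in Set.Ioo (0 : ℝ) 1, f (t • z) * radD g (t • z) / (t : ℂ)

/-- The Hardy space quasinorm `‖f‖_{H^p}`, with values in `ℝ≥0∞`:
`‖f‖_{H^p}^p = sup_{0<r<1} ∫_{S_n} |f(rζ)|^p dσ(ζ)`. -/
def hNorm (n : ℕ) (p : ℝ) (f : En n → ℂ) : ℝ≥0∞ :=
  (⨆ r ∈ Set.Ioo (0 : ℝ) 1,
    ∫⁻ ζ, (‖f (r • ζ)‖₊ : ℝ≥0∞) ^ p ∂(sigmaS n)) ^ (1 / p)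

/-- Membership in the Hardy space `H^p(B_n)`. -/
def MemHp (n : ℕ) (p : ℝ) (f : En n → ℂ) : Prop :=
  DifferentiableOn ℂ f (Bn n) ∧ hNorm n p f < ⊤

/-- The Carleson box `B_δ(ζ) = {z ∈ B_n : |1 - ⟨z,ζ⟩| < δ}`. -/
def cBox {n : ℕ} (ζ : En n) (δ : ℝ) : Set (En n) :=
  {z ∈ Bn n | ‖(1 : ℂ) - herm z ζ‖ < δ}

/-- The measure `dμ_g(z) = |Rg(z)|²(1-|z|²) dv(z)`. -/
def muJ (n : ℕ) (g : En n → ℂ) : Measure (En n) :=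
  (volN n).withDensity
    (fun z => (‖radD g z‖₊ : ℝ≥0∞) ^ 2 * ENNReal.ofReal (1 - ‖z‖ ^ 2))

/-- The admissible approach region `Γ_α(ζ) = {z ∈ B_n : |1-⟨z,ζ⟩| < (α/2)(1-|z|²)}`. -/
def Gam {n : ℕ} (α : ℝ) (ζ : En n) : Set (En n) :=
  {z ∈ Bn n | ‖(1 : ℂ) - herm z ζ‖ < α / 2 * (1 - ‖z‖ ^ 2)}

open Classical in
/-- The involutive automorphism `φ_a` of the unit ball interchanging `0` and `a`:
`φ_a(z) = (a - P_a z - √(1-|a|²) (z - P_a z)) / (1 - ⟨z,a⟩)`, where `P_a` is the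
orthogonal projection onto `ℂa`. -/
def mob {n : ℕ} (a z : En n) : En n :=
  if a = 0 then -z
  else ((1 : ℂ) - herm z a)⁻¹ •
    ((a - (herm z a / herm a a) • a) -
      ((Real.sqrt (1 - ‖a‖ ^ 2) : ℂ)) • (z - (herm z a / herm a a) • a))

/-- The norm of the invariant (real) gradient `∇̃f(z) = ∇(f ∘ φ_z)(0)`. -/
def invGrad {n : ℕ} {F : Type*} [NormedAddCommGroup F] [NormedSpace ℝ F]
    (f : En n → F) (z : En n) : ℝ :=
  ‖fderiv ℝ (fun w => f (mob z w)) 0‖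

/-- The invariant measure `dλ_n(z) = (1-|z|²)^{-(n+1)} dv(z)`. -/
def lamN (n : ℕ) : Measure (En n) :=
  (volN n).withDensity (fun z => ENNReal.ofReal ((1 - ‖z‖ ^ 2) ^ (-(n + 1 : ℝ))))

/-- The invariant Poisson integral `u_φ(z) = ∫_{S_n} φ(ζ) (1-|z|²)ⁿ/|1-⟨z,ζ⟩|^{2n} dσ(ζ)`. -/
def poisson (n : ℕ) (φ : En n → ℝ) (z : En n) : ℝ :=
  ∫ ζ, φ ζ * ((1 - ‖z‖ ^ 2) ^ n / ‖(1 : ℂ) - herm z ζ‖ ^ (2 * n)) ∂(sigmaS n)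

/-- The function `μ̃(ζ) = ∫_{Γ_α(ζ)} (1-|z|²)^{-n} dμ(z)`. -/
def tildeMu (n : ℕ) (α : ℝ) (μ : Measure (En n)) (ζ : En n) : ℝ≥0∞ :=
  ∫⁻ z in Gam α ζ, ENNReal.ofReal ((1 - ‖z‖ ^ 2) ^ (-(n : ℝ))) ∂μ

/-- The `L^{p/(p-s)}(S_n)`-norm of `μ̃`. -/
def tildeMuNorm (n : ℕ) (α p s : ℝ) (μ : Measure (En n)) : ℝ≥0∞ :=
  (∫⁻ ζ, tildeMu n α μ ζ ^ (p / (p - s)) ∂(sigmaS n)) ^ ((p - s) / p)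

section UniformlyDistributed

variable {X : Type*} [MetricSpace X] [CompactSpace X] [MeasurableSpace X] [BorelSpace X]

theorem measure_mul_measure_ball_le (μ ν : Measure X) [IsFiniteMeasure μ] [IsFiniteMeasure ν]
    (hμ : ∀ r x y, μ (ball x r) = μ (ball y r)) (hν : ∀ r x y, ν (ball x r) = ν (ball y r))
    (x₀ : X) {K O : Set X} (hK : MeasurableSet K) (hO : MeasurableSet O) {r : ℝ}
    (h : thickening r K ⊆ O) :
    μ K * ν (ball x₀ r) ≤ μ (ball x₀ r) * ν O := by
  have hm : MeasurableSet {z : X × X | dist z.1 z.2 < r} :=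
    (isOpen_lt continuous_dist continuous_const).measurableSet
  have hF : Measurable (fun z : X × X => {z : X × X | dist z.1 z.2 < r}.indicator
      (fun _ => (1 : ℝ≥0∞)) z) := measurable_const.indicator hm
  have h1 : ∀ x, ∫⁻ y, {z : X × X | dist z.1 z.2 < r}.indicator (fun _ => (1 : ℝ≥0∞)) (x, y) ∂ν
      = ν (ball x₀ r) := by
    intro x
    rw [hν r x₀ x, ← lintegral_indicator_one measurableSet_ball]
    refine lintegral_congr fun y => ?_
    simp [indicator, dist_comm]
  have h2 : ∀ y, ∫⁻ x, {z : X × X | dist z.1 z.2 < r}.indicator (fun _ => (1 : ℝ≥0∞)) (x, y) ∂μ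
      = μ (ball x₀ r) := by
    intro y
    rw [hμ r x₀ y, ← lintegral_indicator_one measurableSet_ball]
    refine lintegral_congr fun x => ?_
    simp [indicator]
  calc μ K * ν (ball x₀ r)
      = ∫⁻ x in K, ∫⁻ y, {z : X × X | dist z.1 z.2 < r}.indicator
          (fun _ => (1 : ℝ≥0∞)) (x, y) ∂ν ∂μ := by
        simp_rw [h1]; simp [mul_comm]
    _ = ∫⁻ y, ∫⁻ x in K, {z : X × X | dist z.1 z.2 < r}.indicator
          (fun _ => (1 : ℝ≥0∞)) (x, y) ∂μ ∂ν :=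
        lintegral_lintegral_swap hF.aemeasurable
    _ ≤ ∫⁻ y, O.indicator (fun _ => μ (ball x₀ r)) y ∂ν := by
        refine lintegral_mono fun y => ?_
        by_cases hy : y ∈ O
        · rw [indicator_of_mem hy, ← h2 y]
          exact setLIntegral_le_lintegral _ _
        · rw [indicator_of_notMem hy]
          rw [← lintegral_indicator hK, nonpos_iff_eq_zero]
          refine (lintegral_congr fun x => ?_).trans lintegral_zero
          by_cases hx : x ∈ K
          · rw [indicator_of_mem hx, indicator_of_notMem]
            intro hxy
            exact hy (h (mem_thickening_iff.2 ⟨x, hx, by simpa [dist_comm] using hxy⟩))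
          · rw [indicator_of_notMem hx]
    _ = μ (ball x₀ r) * ν O := by
        rw [lintegral_indicator_const hO]

theorem measure_mul_univ_le_of_uniform (μ ν : Measure X) [IsFiniteMeasure μ] [IsFiniteMeasure ν]
    (hμ : ∀ r x y, μ (ball x r) = μ (ball y r)) (hν : ∀ r x y, ν (ball x r) = ν (ball y r))
    (hν0 : ν ≠ 0) : ν univ • μ ≤ μ univ • ν := by
  have : Nonempty X := by
    by_contra hX
    rw [not_nonempty_iff] at hX
    exact hν0 (Measure.eq_zero_of_isEmpty ν)
  obtain ⟨x₀⟩ := this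
  have hpos : ∀ r, 0 < r → ν (ball x₀ r) ≠ 0 := by
    intro r hr h0
    apply hν0
    rw [← Measure.measure_univ_eq_zero]
    refine measure_null_of_locally_null _ fun x _ => ⟨ball x r, ?_, ?_⟩
    · exact mem_nhdsWithin_of_mem_nhds (ball_mem_nhds x hr)
    · rw [hν r x x₀, h0]
  have key : ∀ K O : Set X, IsCompact K → IsOpen O → K ⊆ O →
      ν univ * μ K ≤ μ univ * ν O := by
    intro K O hK hO hKO
    obtain ⟨r, hr, hrO⟩ := hK.exists_thickening_subset_open hO hKO
    have a := measure_mul_measure_ball_le μ ν hμ hν x₀ hK.measurableSet hO.measurableSet hrO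
    have b := measure_mul_measure_ball_le ν μ hν hμ x₀ MeasurableSet.univ MeasurableSet.univ
      (subset_univ (thickening r univ))
    have h0 := hpos r hr
    have h1 := measure_ne_top ν (ball x₀ r)
    refine (ENNReal.mul_le_mul_iff_right h0 h1).1 ?_
    calc ν (ball x₀ r) * (ν univ * μ K) = ν univ * (μ K * ν (ball x₀ r)) := by ring
      _ ≤ ν univ * (μ (ball x₀ r) * ν O) := by gcongr
      _ = (ν univ * μ (ball x₀ r)) * ν O := by ring
      _ ≤ (ν (ball x₀ r) * μ univ) * ν O := by gcongr
      _ = _ := by ring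
  have key2 : ∀ K : Set X, IsCompact K → ν univ * μ K ≤ μ univ * ν K := by
    intro K hK
    by_cases hμ0 : μ univ = 0
    · have : μ K = 0 := measure_mono_null (subset_univ _) hμ0
      simp [this]
    rw [mul_comm (μ univ), ← ENNReal.div_le_iff_le_mul (.inl hμ0) (.inl (measure_ne_top _ _))]
    rw [K.measure_eq_iInf_isOpen ν]
    refine le_iInf₂ fun O hKO => le_iInf fun hO => ?_
    rw [ENNReal.div_le_iff_le_mul (.inl hμ0) (.inl (measure_ne_top _ _)), mul_comm (ν O)]
    exact key K O hK hO hKO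
  refine Measure.le_iff.2 fun A hA => ?_
  simp only [Measure.smul_apply, smul_eq_mul]
  rw [hA.measure_eq_iSup_isCompact_of_ne_top (measure_ne_top μ A)]
  simp only [ENNReal.mul_iSup]
  refine iSup₂_le fun K hKA => iSup_le fun hK => (key2 K hK).trans ?_
  gcongr

theorem measure_eq_smul_of_uniform (μ ν : Measure X) [IsFiniteMeasure μ] [IsFiniteMeasure ν]
    (hμ : ∀ r x y, μ (ball x r) = μ (ball y r)) (hν : ∀ r x y, ν (ball x r) = ν (ball y r))
    (hμ0 : μ ≠ 0) (hν0 : ν ≠ 0) : ν univ • μ = μ univ • ν :=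
  le_antisymm (measure_mul_univ_le_of_uniform μ ν hμ hν hν0)
    (measure_mul_univ_le_of_uniform ν μ hν hμ hμ0)

end UniformlyDistributed

section SphereHausdorff

variable {E : Type*} [NormedAddCommGroup E] [InnerProductSpace ℝ E] [FiniteDimensional ℝ E]
  [MeasurableSpace E] [BorelSpace E]

open Module in
theorem hausdorffMeasure_hemisphere_lt_top {m : ℕ} (hE : finrank ℝ E = m + 1) {v : E}
    (hv : ‖v‖ = 1) : μH[(m : ℝ)] {x ∈ sphere (0 : E) 1 | inner ℝ v x ≤ 0} < ⊤ := by
  have : Fact (finrank ℝ E = m + 1) := ⟨hE⟩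
  have hv0 : v ≠ 0 := by
    rintro rfl
    simp at hv
  have hW : finrank ℝ (ℝ ∙ v)ᗮ = m := Submodule.finrank_orthogonal_span_singleton hv0
  let F : (ℝ ∙ v)ᗮ → E := fun w => stereoInvFunAux v (w : E)
  have hF : ContDiff ℝ 1 F := contDiff_stereoInvFunAux.comp (ℝ ∙ v)ᗮ.subtypeL.contDiff
  have hcomp : IsCompact (closedBall (0 : (ℝ ∙ v)ᗮ) 2) := isCompact_closedBall _ _
  obtain ⟨C, hC⟩ := hcomp.exists_bound_of_continuousOn
    (hF.continuous_fderiv one_ne_zero).continuousOn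
  have hLip : LipschitzOnWith C.toNNReal F (closedBall 0 2) := by
    refine (convex_closedBall _ _).lipschitzOnWith_of_nnnorm_fderiv_le (𝕜 := ℝ)
      (fun x _ => (hF.differentiable one_ne_zero) x) fun x hx => ?_
    rw [← NNReal.coe_le_coe, coe_nnnorm]
    exact (hC x hx).trans (Real.le_coe_toNNReal C)
  have hsub : {x ∈ sphere (0 : E) 1 | inner ℝ v x ≤ 0} ⊆ F '' closedBall 0 2 := by
    rintro x ⟨hx, hvx⟩
    have hxv : x ≠ v := by
      rintro rfl
      rw [real_inner_self_eq_norm_sq, hv] at hvx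
      norm_num at hvx
    refine ⟨stereoToFun v x, ?_, ?_⟩
    · rw [mem_closedBall_zero_iff, stereoToFun_apply, norm_smul]
      have h1 : ‖(2 : ℝ) / (1 - innerSL ℝ v x)‖ ≤ 2 := by
        have : (1 : ℝ) ≤ 1 - innerSL ℝ v x := by simpa using hvx
        rw [Real.norm_eq_abs, abs_of_nonneg (by positivity)]
        exact div_le_self (by norm_num) this
      have h2 : ‖(ℝ ∙ v)ᗮ.orthogonalProjectionOnto x‖ ≤ 1 := by
        refine ((ℝ ∙ v)ᗮ.norm_orthogonalProjectionOnto_apply_le x).trans ?_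
        rw [mem_sphere_zero_iff_norm.1 hx]
      calc _ ≤ (2 : ℝ) * 1 := by gcongr
        _ = 2 := by norm_num
    · have := stereo_left_inv hv (x := ⟨x, hx⟩) hxv
      exact congrArg Subtype.val this
  calc _ ≤ μH[(m : ℝ)] (F '' closedBall 0 2) := measure_mono hsub
    _ ≤ (C.toNNReal : ℝ≥0∞) ^ (m : ℝ) * μH[(m : ℝ)] (closedBall (0 : (ℝ ∙ v)ᗮ) 2) :=
      hLip.hausdorffMeasure_image_le (by positivity)
    _ < ⊤ := by
      refine ENNReal.mul_lt_top (by simp) ?_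
      rw [← hW]
      exact hcomp.measure_lt_top

open Module in
theorem hausdorffMeasure_sphere_lt_top {m : ℕ} (hE : finrank ℝ E = m + 1) :
    μH[(m : ℝ)] (sphere (0 : E) 1) < ⊤ := by
  have : Nontrivial E := Module.nontrivial_of_finrank_pos (R := ℝ) (by omega)
  obtain ⟨v, hv⟩ := exists_norm_eq E zero_le_one
  refine (measure_mono ?_).trans_lt (measure_union_lt_top
    (hausdorffMeasure_hemisphere_lt_top hE hv)
    (hausdorffMeasure_hemisphere_lt_top hE (v := -v) (by simpa using hv)))
  intro x hx
  rcases le_total (inner ℝ v x) 0 with h | h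
  · exact .inl ⟨hx, h⟩
  · exact .inr ⟨hx, by simpa using h⟩

open Module in
theorem hausdorffMeasure_sphere_pos {m : ℕ} (hE : finrank ℝ E = m + 1) :
    0 < μH[(m : ℝ)] (sphere (0 : E) 1) := by
  have : Fact (finrank ℝ E = m + 1) := ⟨hE⟩
  have : Nontrivial E := Module.nontrivial_of_finrank_pos (R := ℝ) (by omega)
  obtain ⟨v, hv⟩ := exists_norm_eq E zero_le_one
  have hv0 : v ≠ 0 := by
    rintro rfl
    simp at hv
  have hW : finrank ℝ (ℝ ∙ v)ᗮ = m := Submodule.finrank_orthogonal_span_singleton hv0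
  let P : E → (ℝ ∙ v)ᗮ := fun x => (ℝ ∙ v)ᗮ.orthogonalProjectionOnto x
  have hP : LipschitzWith 1 P := by
    refine LipschitzWith.of_dist_le_mul fun x y => ?_
    rw [dist_eq_norm, dist_eq_norm, ← map_sub]
    simpa using (ℝ ∙ v)ᗮ.norm_orthogonalProjectionOnto_apply_le (x - y)
  have hsub : ball (0 : (ℝ ∙ v)ᗮ) 1 ⊆ P '' sphere (0 : E) 1 := by
    intro w hw
    rw [mem_ball_zero_iff] at hw
    have hwv : inner ℝ (w : E) v = 0 := by
      have := w.2
      rwa [Submodule.mem_orthogonal_singleton_iff_inner_left] at this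
    have hnn : 0 ≤ 1 - ‖w‖ ^ 2 := by nlinarith [norm_nonneg w]
    refine ⟨(w : E) + Real.sqrt (1 - ‖w‖ ^ 2) • v, ?_, ?_⟩
    · rw [mem_sphere_zero_iff_norm, ← sq_eq_sq₀ (norm_nonneg _) zero_le_one,
        norm_add_sq_real, inner_smul_right, hwv, norm_smul, hv, Real.norm_eq_abs, mul_one,
        sq_abs, Real.sq_sqrt hnn]
      simp
    · simp only [P, map_add, map_smul]
      rw [Submodule.orthogonalProjectionOnto_mem_subspace_eq_self,
        Submodule.orthogonalProjectionOnto_orthogonalComplement_singleton_eq_zero]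
      simp

  have h1 : 0 < μH[(m : ℝ)] (ball (0 : (ℝ ∙ v)ᗮ) 1) := by
    rw [← hW]
    exact measure_ball_pos _ _ one_pos
  calc 0 < μH[(m : ℝ)] (ball (0 : (ℝ ∙ v)ᗮ) 1) := h1
    _ ≤ μH[(m : ℝ)] (P '' sphere (0 : E) 1) := measure_mono hsub
    _ ≤ _ := by
      simpa using hP.hausdorffMeasure_image_le (Nat.cast_nonneg m) (sphere (0 : E) 1)

end SphereHausdorff

section Polar

variable {E : Type*} [NormedAddCommGroup E] [InnerProductSpace ℝ E] [MeasurableSpace E]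
  [BorelSpace E]

theorem hausdorffMeasure_sphere_ball_eq {d : ℝ} (hd : 0 ≤ d) (r : ℝ) (x y : sphere (0 : E) 1) :
    μH[d] (ball x r) = μH[d] (ball y r) := by
  have hxy : ‖(x : E)‖ = ‖(y : E)‖ := by simp
  set L := Submodule.reflection (ℝ ∙ ((x : E) - y))ᗮ with hL
  have hLx : L x = y := Submodule.reflection_sub hxy
  symm
  rw [← isometry_subtype_coe.hausdorffMeasure_image (.inl hd),
    ← isometry_subtype_coe.hausdorffMeasure_image (.inl hd) (ball x r),
    Subtype.image_ball, Subtype.image_ball, ← L.toIsometryEquiv.hausdorffMeasure_preimage]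
  congr 1
  ext z
  simp only [mem_inter_iff, mem_preimage]
  change L z ∈ ball (y : E) r ∧ L z ∈ sphere (0 : E) 1 ↔ _
  rw [← hLx, mem_ball, mem_ball, L.dist_map]
  simp

variable [FiniteDimensional ℝ E]

open scoped Pointwise in
theorem toSphere_ball_eq (r : ℝ) (x y : sphere (0 : E) 1) :
    (volume : Measure E).toSphere (ball x r) = (volume : Measure E).toSphere (ball y r) := by
  have hxy : ‖(x : E)‖ = ‖(y : E)‖ := by simp
  set L := Submodule.reflection (ℝ ∙ ((x : E) - y))ᗮ with hL
  have hLx : L x = y := Submodule.reflection_sub hxy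
  have hset : ∀ z, z ∈ Ioo (0 : ℝ) 1 • (ball (x : E) r ∩ sphere (0 : E) 1) ↔
      L z ∈ Ioo (0 : ℝ) 1 • (ball (y : E) r ∩ sphere (0 : E) 1) := by
    intro z
    simp only [Set.mem_smul]
    constructor
    · rintro ⟨t, ht, w, ⟨hw, hw1⟩, rfl⟩
      refine ⟨t, ht, L w, ⟨?_, by simpa using hw1⟩, by simp⟩
      rw [mem_ball, ← hLx, L.dist_map]
      exact hw
    · rintro ⟨t, ht, w, ⟨hw, hw1⟩, h⟩
      refine ⟨t, ht, L.symm w, ⟨?_, by simpa using hw1⟩, ?_⟩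
      · rw [mem_ball, ← L.dist_map, hLx]
        simpa using hw
      · rw [← map_smul, h]
        simp
  rw [Measure.toSphere_apply' _ measurableSet_ball, Measure.toSphere_apply' _ measurableSet_ball,
    Subtype.image_ball, Subtype.image_ball]
  congr 1
  symm
  rw [← L.measurePreserving.measure_preimage_equiv (f := L.toHomeomorph.toMeasurableEquiv)]
  congr 1
  ext z
  exact (hset z).symm

/-- The normalized Hausdorff measure on the unit sphere. -/
def normSphere (E : Type*) [NormedAddCommGroup E] [MeasurableSpace E] [BorelSpace E]
    (d : ℝ) : Measure E :=
  (μH[d] (sphere (0 : E) 1))⁻¹ • μH[d].restrict (sphere (0 : E) 1)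

open Module in
theorem normSphere_univ {m : ℕ} (hE : finrank ℝ E = m + 1) : normSphere E m univ = 1 := by
  simp only [normSphere, Measure.smul_apply, Measure.restrict_apply_univ, smul_eq_mul]
  exact ENNReal.inv_mul_cancel (hausdorffMeasure_sphere_pos hE).ne'
    (hausdorffMeasure_sphere_lt_top hE).ne

open Module in
theorem exists_toSphere_eq {m : ℕ} (hE : finrank ℝ E = m + 1) :
    ∃ κ : ℝ≥0∞, κ ≠ 0 ∧ κ ≠ ⊤ ∧
      (volume : Measure E).toSphere.map (↑) = κ • normSphere E m := by
  have : Nontrivial E := Module.nontrivial_of_finrank_pos (R := ℝ) (by omega)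
  have hm : (0 : ℝ) ≤ m := Nat.cast_nonneg m
  set S := sphere (0 : E) 1
  have hmap : Measure.map ((↑) : S → E) μH[(m : ℝ)] = μH[(m : ℝ)].restrict S := by
    rw [isometry_subtype_coe.map_hausdorffMeasure (.inl hm), Subtype.range_coe]
  have huniv : (μH[(m : ℝ)] : Measure S) univ = μH[(m : ℝ)] S := by
    rw [← isometry_subtype_coe.hausdorffMeasure_image (.inl hm), image_univ, Subtype.range_coe]
  have hpos := hausdorffMeasure_sphere_pos hE
  have hfin := hausdorffMeasure_sphere_lt_top hE
  have : IsFiniteMeasure (μH[(m : ℝ)] : Measure S) := ⟨by rw [huniv]; exact hfin⟩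
  have hne : (μH[(m : ℝ)] : Measure S) ≠ 0 := by
    rw [← Measure.measure_univ_ne_zero, huniv]
    exact hpos.ne'
  have h := measure_eq_smul_of_uniform (volume : Measure E).toSphere (μH[(m : ℝ)] : Measure S)
    toSphere_ball_eq (hausdorffMeasure_sphere_ball_eq hm) (Measure.toSphere_ne_zero _) hne
  rw [huniv] at h
  refine ⟨(volume : Measure E).toSphere univ, ?_, measure_ne_top _ _, ?_⟩
  · rw [Measure.measure_univ_ne_zero]
    exact Measure.toSphere_ne_zero _
  · rw [normSphere, ← hmap]
    have h2 := congrArg (fun ν => (μH[(m : ℝ)] S)⁻¹ • Measure.map ((↑) : S → E) ν) h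
    simp only [Measure.map_smul] at h2
    rw [← smul_assoc, smul_eq_mul, ENNReal.inv_mul_cancel hpos.ne' hfin.ne, one_smul] at h2
    rw [h2, smul_comm]

open Module in
theorem lintegral_polar {m : ℕ} (hE : finrank ℝ E = m + 1) :
    ∃ κ : ℝ≥0∞, κ ≠ 0 ∧ κ ≠ ⊤ ∧ ∀ Φ : E → ℝ≥0∞, Measurable Φ →
      ∫⁻ z, Φ z = κ * ∫⁻ r in Ioi (0 : ℝ), ENNReal.ofReal (r ^ m) *
        ∫⁻ ζ, Φ (r • ζ) ∂(normSphere E m) := by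
  have : Nontrivial E := Module.nontrivial_of_finrank_pos (R := ℝ) (by omega)
  obtain ⟨κ, h0, h1, hκ⟩ := exists_toSphere_eq hE
  refine ⟨κ, h0, h1, fun Φ hΦ => ?_⟩
  have hin : ∀ r : ℝ, ∫⁻ ζ : sphere (0 : E) 1, Φ (r • (ζ : E)) ∂(volume : Measure E).toSphere
      = κ * ∫⁻ ζ, Φ (r • ζ) ∂(normSphere E m) := by
    intro r
    rw [← smul_eq_mul, ← lintegral_smul_measure, ← hκ, lintegral_map _ measurable_subtype_coe]
    fun_prop
  have hc : ∫⁻ z, Φ z = ∫⁻ z : ({0}ᶜ : Set E), Φ z ∂((volume : Measure E).comap (↑)) := by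
    rw [lintegral_subtype_comap (measurableSet_singleton _).compl, restrict_compl_singleton]
  have hmp := Measure.measurePreserving_homeomorphUnitSphereProd (volume : Measure E)
  have hf : Measurable fun p : sphere (0 : E) 1 × Ioi (0 : ℝ) => Φ ((p.2 : ℝ) • (p.1 : E)) := by
    fun_prop
  have h2 := hmp.lintegral_comp hf
  have hg : ∀ z : ({0}ᶜ : Set E), Φ (((homeomorphUnitSphereProd E z).2 : ℝ) •
      ((homeomorphUnitSphereProd E z).1 : E)) = Φ z := by
    intro z
    congr 1
    exact congrArg Subtype.val ((homeomorphUnitSphereProd E).symm_apply_apply z)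
  simp only [hg] at h2
  rw [hc, h2, lintegral_prod_symm' _ hf, hE, Nat.add_sub_cancel]
  simp only [hin]
  have hmeas : Measurable fun r : ℝ => ∫⁻ ζ, Φ (r • ζ) ∂(normSphere E m) := by
    have : SFinite (normSphere E m) := by
      have : IsFiniteMeasure (normSphere E m) := ⟨by rw [normSphere_univ hE]; simp⟩
      infer_instance
    refine Measurable.lintegral_prod_right' (f := fun p : ℝ × E => Φ (p.1 • p.2)) ?_
    fun_prop
  have hmeas' : Measurable fun r : Ioi (0 : ℝ) =>
      ∫⁻ ζ, Φ ((r : ℝ) • ζ) ∂(normSphere E m) := hmeas.comp measurable_subtype_coe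
  rw [lintegral_const_mul _ hmeas', Measure.volumeIoiPow,
    lintegral_withDensity_eq_lintegral_mul _ (by fun_prop) hmeas']
  congr 1
  exact lintegral_subtype_comap measurableSet_Ioi
    (fun r : ℝ => ENNReal.ofReal (r ^ m) * ∫⁻ ζ, Φ (r • ζ) ∂(normSphere E m))

end Polar

section SubMeanValue

theorem log_norm_le_circleAverage {φ : ℂ → ℂ} (hφ : AnalyticOnNhd ℂ φ (closedBall 0 1))
    (h0 : φ 0 ≠ 0) : Real.log ‖φ 0‖ ≤ Real.circleAverage (Real.log ‖φ ·‖) 0 1 := by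
  have h1 : AnalyticOnNhd ℂ φ (closedBall 0 |1|) := by simpa using hφ
  rw [h1.circleAverage_log_norm one_ne_zero h0]
  refine le_add_of_nonneg_left (finsum_nonneg fun u => ?_)
  by_cases hu : u ∈ closedBall (0 : ℂ) |1|
  · refine mul_nonneg (by exact_mod_cast MeromorphicOn.AnalyticOnNhd.divisor_nonneg h1 u) ?_
    rcases eq_or_ne u 0 with rfl | hu0
    · simp
    · refine Real.log_nonneg ?_
      rw [one_mul, zero_sub, norm_neg]
      exact (one_le_inv₀ (norm_pos_iff.2 hu0)).2 (by simpa using hu)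
  · rw [Function.locallyFinsuppWithin.apply_eq_zero_of_notMem _ hu]
    simp

theorem rpow_norm_le_circleAverage {φ : ℂ → ℂ} (hφ : AnalyticOnNhd ℂ φ (closedBall 0 1))
    {q : ℝ} (hq : 0 < q) : ‖φ 0‖ ^ q ≤ Real.circleAverage (fun z => ‖φ z‖ ^ q) 0 1 := by
  have hcont : ContinuousOn (fun z => ‖φ z‖ ^ q) (sphere 0 1) :=
    ((hφ.continuousOn.mono sphere_subset_closedBall).norm).rpow_const fun _ _ => .inr hq.le
  have hci : CircleIntegrable (fun z => ‖φ z‖ ^ q) 0 1 := hcont.circleIntegrable zero_le_one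
  rcases eq_or_ne (φ 0) 0 with h0 | h0
  · rw [h0, norm_zero, Real.zero_rpow hq.ne']
    exact Real.circleAverage_nonneg_of_nonneg fun x _ => by positivity
  set A := ‖φ 0‖ with hA
  have hA0 : 0 < A := norm_pos_iff.2 h0
  have hAq : 0 < A ^ q := Real.rpow_pos_of_pos hA0 q
  set f₂ : ℂ → ℝ := fun z => if φ z = 0 then Real.log A - q⁻¹ else Real.log ‖φ z‖ with hf₂
  have hcod : φ ⁻¹' {0}ᶜ ∈ codiscreteWithin (sphere (0 : ℂ) |1|) := by
    refine codiscreteWithin_mono (U₁ := sphere (0 : ℂ) |1|) (U := closedBall (0 : ℂ) 1) ?_ ?_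
    · simpa using sphere_subset_closedBall
    · exact hφ.preimage_zero_mem_codiscreteWithin h0 (by simp)
        ⟨⟨0, by simp⟩, (convex_closedBall (0 : ℂ) 1).isPreconnected⟩
  have heq : (Real.log ‖φ ·‖) =ᶠ[codiscreteWithin (sphere (0 : ℂ) |1|)] f₂ := by
    filter_upwards [hcod] with z hz
    simp only [hf₂]
    rw [if_neg (by simpa using hz)]
  have hmer : MeromorphicOn φ (sphere 0 |1|) := fun z hz =>
    (hφ z (by simpa using sphere_subset_closedBall hz)).meromorphicAt
  have hi1 : CircleIntegrable (Real.log ‖φ ·‖) 0 1 := hmer.circleIntegrable_log_norm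
  have hi2 : CircleIntegrable f₂ 0 1 := hi1.congr_codiscreteWithin heq
  have hle : ∀ z ∈ sphere (0 : ℂ) |1|,
      A ^ q * (1 - q * Real.log A) + A ^ q * q * f₂ z ≤ ‖φ z‖ ^ q := by
    intro z _
    simp only [hf₂]
    split_ifs with hz
    · rw [hz, norm_zero, Real.zero_rpow hq.ne']
      have : A ^ q * (1 - q * Real.log A) + A ^ q * q * (Real.log A - q⁻¹) = 0 := by
        field_simp
        ring
      exact this.le
    · have hz0 : 0 < ‖φ z‖ := norm_pos_iff.2 hz
      have h1 := Real.add_one_le_exp (q * (Real.log ‖φ z‖ - Real.log A))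
      have h2 : A ^ q * Real.exp (q * (Real.log ‖φ z‖ - Real.log A)) = ‖φ z‖ ^ q := by
        rw [Real.rpow_def_of_pos hA0, Real.rpow_def_of_pos hz0, ← Real.exp_add]
        ring_nf
      rw [← h2]
      nlinarith
  have hi3 : CircleIntegrable (fun z => A ^ q * q * f₂ z) 0 1 := hi2.const_fun_smul
  have hmono := Real.circleAverage_mono (f₁ := fun z => A ^ q * (1 - q * Real.log A) +
      A ^ q * q * f₂ z) ((circleIntegrable_const _ _ _).add hi3) hci hle
  rw [Real.circleAverage_fun_add (circleIntegrable_const _ _ _) hi3,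
    Real.circleAverage_const] at hmono
  have hsm : Real.circleAverage (fun z => A ^ q * q * f₂ z) 0 1
      = A ^ q * q * Real.circleAverage f₂ 0 1 := by
    simpa only [smul_eq_mul] using
      Real.circleAverage_fun_smul (a := A ^ q * q) (f := f₂) (c := 0) (R := 1)
  rw [hsm, ← Real.circleAverage_congr_codiscreteWithin heq one_ne_zero] at hmono
  have hlog := log_norm_le_circleAverage hφ h0
  refine le_trans ?_ hmono
  have : A ^ q * q * Real.log A ≤ A ^ q * q * Real.circleAverage (Real.log ‖φ ·‖) 0 1 := by
    gcongr
  nlinarith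

theorem enorm_rpow_mul_le_lintegral {φ : ℂ → ℂ} (hφ : AnalyticOnNhd ℂ φ (closedBall 0 1))
    {q : ℝ} (hq : 0 < q) : ENNReal.ofReal (2 * Real.pi) * ‖φ 0‖ₑ ^ q ≤
      ∫⁻ θ in Ioc 0 (2 * Real.pi), ‖φ (circleMap 0 1 θ)‖ₑ ^ q := by
  have h := rpow_norm_le_circleAverage hφ hq
  have hpi : 0 < 2 * Real.pi := by positivity
  have hcont : ContinuousOn (fun z => ‖φ z‖ ^ q) (sphere 0 1) :=
    ((hφ.continuousOn.mono sphere_subset_closedBall).norm).rpow_const fun _ _ => .inr hq.le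
  have hci : CircleIntegrable (fun z => ‖φ z‖ ^ q) 0 1 := hcont.circleIntegrable zero_le_one
  rw [Real.circleAverage_def, smul_eq_mul, ← div_eq_inv_mul, le_div_iff₀ hpi,
    intervalIntegral.integral_of_le hpi.le] at h
  have h2 := ENNReal.ofReal_le_ofReal h
  rw [ofReal_integral_eq_lintegral_ofReal hci.1 (Eventually.of_forall fun x => by positivity),
    mul_comm, ENNReal.ofReal_mul hpi.le, ← ENNReal.ofReal_rpow_of_nonneg (norm_nonneg _) hq.le,
    ofReal_norm] at h2
  refine h2.trans (lintegral_mono fun θ => ?_)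
  rw [← ENNReal.ofReal_rpow_of_nonneg (norm_nonneg _) hq.le, ofReal_norm]

end SubMeanValue

section Dilation

variable {n : ℕ}

/-- The anisotropic dilation `z ↦ δ² ⟨u, z⟩ u + δ (z - ⟨u, z⟩ u)`. -/
def dil (u : En n) (δ : ℝ) : En n →ₗ[ℂ] En n :=
  (δ : ℂ) • LinearMap.transvection (((δ : ℂ) - 1) • (innerSL ℂ u).toLinearMap) u

theorem dil_apply (u : En n) (δ : ℝ) (z : En n) :
    dil u δ z = (δ : ℂ) • (z + (((δ : ℂ) - 1) * inner ℂ u z) • u) := by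
  simp [dil, LinearMap.transvection]

theorem inner_dil {u : En n} (hu : ‖u‖ = 1) (δ : ℝ) (z : En n) :
    inner ℂ u (dil u δ z) = (δ : ℂ) ^ 2 * inner ℂ u z := by
  rw [dil_apply, inner_smul_right, inner_add_right, inner_smul_right,
    inner_self_eq_norm_sq_to_K, hu]
  push_cast
  ring

theorem norm_dil_sq {u : En n} (hu : ‖u‖ = 1) (δ : ℝ) (z : En n) :
    ‖dil u δ z‖ ^ 2 = δ ^ 2 * (‖z‖ ^ 2 + (δ ^ 2 - 1) * ‖(inner ℂ u z : ℂ)‖ ^ 2) := by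
  rw [dil_apply, norm_smul, mul_pow, Complex.norm_real, Real.norm_eq_abs, sq_abs]
  congr 1
  rw [@norm_add_sq ℂ, inner_smul_right, norm_smul, hu, norm_mul, mul_one, mul_pow]
  have h1 : ‖((δ : ℂ) - 1)‖ ^ 2 = (δ - 1) ^ 2 := by
    rw [← Complex.ofReal_one, ← Complex.ofReal_sub, Complex.norm_real, Real.norm_eq_abs, sq_abs]
  have h2 : (inner ℂ u z : ℂ) * inner ℂ z u = ((‖(inner ℂ u z : ℂ)‖ ^ 2 : ℝ) : ℂ) := by
    rw [← inner_conj_symm z u, Complex.mul_conj, Complex.normSq_eq_norm_sq]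
  rw [mul_assoc, h2, h1, ← Complex.ofReal_one, ← Complex.ofReal_sub, ← Complex.ofReal_mul]
  simp only [RCLike.re_to_complex, Complex.ofReal_re]
  ring

theorem det_dil {u : En n} (hu : ‖u‖ = 1) (δ : ℝ) :
    LinearMap.det ((dil u δ).restrictScalars ℝ) = δ ^ (2 * (n + 1)) := by
  rw [LinearMap.det_restrictScalars, Algebra.norm_complex_apply, dil, LinearMap.det_smul,
    LinearMap.transvection.det]
  have : (1 : ℂ) + (((δ : ℂ) - 1) • (innerSL ℂ u).toLinearMap) u = δ := by
    simp [hu]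
  rw [this, finrank_euclideanSpace_fin, ← pow_succ, ← Complex.ofReal_pow, Complex.normSq_ofReal,
    ← pow_add]
  ring_nf

theorem continuous_dil (u : En n) (δ : ℝ) : Continuous (dil u δ) :=
  LinearMap.continuous_of_finiteDimensional _

theorem lintegral_dil {u : En n} (hu : ‖u‖ = 1) {δ : ℝ} (hδ : 0 < δ) {Φ : En n → ℝ≥0∞}
    (hΦ : Measurable Φ) :
    ∫⁻ z, Φ z = ENNReal.ofReal (δ ^ (2 * (n + 1))) * ∫⁻ z, Φ (dil u δ z) := by
  have hdet := det_dil hu δ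
  have hpos : 0 < δ ^ (2 * (n + 1)) := by positivity
  have hne : LinearMap.det ((dil u δ).restrictScalars ℝ) ≠ 0 := by rw [hdet]; exact hpos.ne'
  have hmap := Measure.map_linearMap_addHaar_eq_smul_addHaar (volume : Measure (En n)) hne
  have h := lintegral_map (μ := (volume : Measure (En n))) hΦ (continuous_dil u δ).measurable
  rw [← h]
  change _ = _ * ∫⁻ a, Φ a ∂(Measure.map (⇑((dil u δ).restrictScalars ℝ)) volume)
  rw [hmap, lintegral_smul_measure, hdet, smul_eq_mul, ← mul_assoc, ← ENNReal.ofReal_mul hpos.le,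
    abs_of_pos (inv_pos.2 hpos), mul_inv_cancel₀ hpos.ne', ENNReal.ofReal_one, one_mul]

end Dilation

section Growth

variable {n : ℕ}

theorem lintegral_unit_smul {c : ℂ} (hc : ‖c‖ = 1) (G : En n → ℝ≥0∞) :
    ∫⁻ z, G (c • z) = ∫⁻ z, G z := by
  have hc0 : c ≠ 0 := by rintro rfl; simp at hc
  let L : En n ≃ₗᵢ[ℝ] En n :=
    { toLinearEquiv := (LinearEquiv.smulOfNeZero ℂ (En n) c hc0).restrictScalars ℝ
      norm_map' := fun z => by
        change ‖c • z‖ = ‖z‖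
        rw [norm_smul, hc, one_mul] }
  exact L.measurePreserving.lintegral_comp_emb L.toMeasurableEquiv.measurableEmbedding G

theorem measurable_indicator_enorm_rpow {U : Set (En n)} (hU : MeasurableSet U) {h : En n → ℂ}
    (hh : ContinuousOn h U) (q : ℝ) : Measurable (U.indicator fun z => ‖h z‖ₑ ^ q) := by
  classical
  have h1 : Measurable (U.indicator h) := by
    rw [← piecewise_eq_indicator]
    exact hh.measurable_piecewise continuousOn_const hU
  have h2 : (U.indicator fun z => ‖h z‖ₑ ^ q) =
      U.indicator fun z => ‖U.indicator h z‖ₑ ^ q := by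
    refine indicator_congr fun z hz => ?_
    rw [indicator_of_mem hz]
  rw [h2]
  exact (h1.enorm.pow_const q).indicator hU

theorem volume_ball_mul_enorm_rpow_le {H : En n → ℂ} (hH : DifferentiableOn ℂ H (ball 0 1))
    {q : ℝ} (hq : 0 < q) :
    volume (ball (0 : En n) 1) * ‖H 0‖ₑ ^ q ≤ ∫⁻ z in ball (0 : En n) 1, ‖H z‖ₑ ^ q := by
  set G := (ball (0 : En n) 1).indicator fun z => ‖H z‖ₑ ^ q with hG
  have hGm : Measurable G := measurable_indicator_enorm_rpow measurableSet_ball hH.continuousOn q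
  have hpi : ENNReal.ofReal (2 * Real.pi) ≠ 0 := by
    simp [Real.pi_pos]
  have key : ENNReal.ofReal (2 * Real.pi) * (volume (ball (0 : En n) 1) * ‖H 0‖ₑ ^ q) ≤
      ENNReal.ofReal (2 * Real.pi) * ∫⁻ z, G z := by
    calc ENNReal.ofReal (2 * Real.pi) * (volume (ball (0 : En n) 1) * ‖H 0‖ₑ ^ q)
        = ∫⁻ z in ball (0 : En n) 1, ENNReal.ofReal (2 * Real.pi) * ‖H 0‖ₑ ^ q := by
          rw [setLIntegral_const]; ring
      _ ≤ ∫⁻ z in ball (0 : En n) 1, ∫⁻ θ in Ioc 0 (2 * Real.pi), G (circleMap 0 1 θ • z) := by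
          refine setLIntegral_mono' measurableSet_ball fun z hz => ?_
          have hz1 : ‖z‖ < 1 := by simpa using hz
          have hopen : IsOpen {l : ℂ | l • z ∈ ball (0 : En n) 1} :=
            isOpen_ball.preimage (by fun_prop)
          have hana : AnalyticOnNhd ℂ (fun l : ℂ => H (l • z)) (closedBall 0 1) := by
            have hd : DifferentiableOn ℂ (fun l : ℂ => H (l • z))
                {l : ℂ | l • z ∈ ball (0 : En n) 1} :=
              hH.comp (by fun_prop) fun l hl => hl
            refine (hd.analyticOnNhd hopen).mono fun l hl => ?_
            have hl1 : ‖l‖ ≤ 1 := by simpa using hl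
            simp only [mem_ofPred_eq, mem_ball_zero_iff, norm_smul]
            nlinarith [norm_nonneg z]
          have h1 := enorm_rpow_mul_le_lintegral hana hq
          rw [zero_smul] at h1
          refine h1.trans (lintegral_mono fun θ => ?_)
          have : circleMap 0 1 θ • z ∈ ball (0 : En n) 1 := by
            simpa [norm_smul] using hz
          rw [hG, indicator_of_mem this]
      _ ≤ ∫⁻ z, ∫⁻ θ in Ioc 0 (2 * Real.pi), G (circleMap 0 1 θ • z) :=
          setLIntegral_le_lintegral _ _
      _ = ∫⁻ θ in Ioc 0 (2 * Real.pi), ∫⁻ z, G (circleMap 0 1 θ • z) := by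
          refine lintegral_lintegral_swap (Measurable.aemeasurable ?_)
          exact hGm.comp (by fun_prop)
      _ = ENNReal.ofReal (2 * Real.pi) * ∫⁻ z, G z := by
          simp_rw [lintegral_unit_smul (norm_circleMap_zero 1 _ |>.trans abs_one)]
          rw [setLIntegral_const, Real.volume_Ioc, sub_zero, mul_comm]
  rw [hG, lintegral_indicator measurableSet_ball] at key
  exact (ENNReal.mul_le_mul_iff_right hpi ENNReal.ofReal_ne_top).1 key

theorem sigmaS_eq_normSphere (hn : 1 ≤ n) :
    sigmaS n = normSphere (En n) ((2 * n - 1 : ℕ) : ℝ) := by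
  rw [Nat.cast_sub (by omega)]
  simp [sigmaS, normSphere, Sn]

theorem ae_norm_eq_one_sigmaS : ∀ᵐ ζ ∂sigmaS n, ‖ζ‖ = 1 := by
  have h : ∀ᵐ ζ ∂(μH[(2 * n - 1 : ℝ)]).restrict (Sn n), ‖ζ‖ = 1 := by
    filter_upwards [ae_restrict_mem (isClosed_sphere (x := (0 : En n))).measurableSet] with ζ hζ
    simpa [Sn] using hζ
  exact Measure.ae_smul_measure h _

theorem finrank_real_En (n : ℕ) : Module.finrank ℝ (En n) = 2 * n := by
  rw [← Module.finrank_mul_finrank ℝ ℂ, Complex.finrank_real_complex, finrank_euclideanSpace_fin]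

theorem lintegral_polar_sigmaS (hn : 1 ≤ n) :
    ∃ κ : ℝ≥0∞, κ ≠ 0 ∧ κ ≠ ⊤ ∧ ∀ Φ : En n → ℝ≥0∞, Measurable Φ →
      ∫⁻ z, Φ z = κ * ∫⁻ r in Ioi (0 : ℝ), ENNReal.ofReal (r ^ (2 * n - 1)) *
        ∫⁻ ζ, Φ (r • ζ) ∂(sigmaS n) := by
  have : Module.finrank ℝ (En n) = 2 * n - 1 + 1 := by
    rw [finrank_real_En]
    omega
  rw [sigmaS_eq_normSphere hn]
  exact lintegral_polar this

theorem lintegral_sphere_le_hNorm_rpow {q : ℝ} (hq : 0 < q) (h : En n → ℂ) {r : ℝ}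
    (hr : r ∈ Ioo (0 : ℝ) 1) : ∫⁻ ζ, ‖h (r • ζ)‖ₑ ^ q ∂(sigmaS n) ≤ hNorm n q h ^ q := by
  rw [hNorm, ← ENNReal.rpow_mul, one_div_mul_cancel hq.ne', ENNReal.rpow_one]
  exact le_iSup₂_of_le r hr le_rfl

theorem exists_unit_smul_eq (hn : 1 ≤ n) (a : En n) : ∃ u : En n, ‖u‖ = 1 ∧ a = ‖a‖ • u := by
  rcases eq_or_ne a 0 with rfl | ha
  · exact ⟨EuclideanSpace.single ⟨0, hn⟩ 1, by simp, by simp⟩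
  · refine ⟨‖a‖⁻¹ • a, ?_, ?_⟩
    · rw [norm_smul, norm_inv, norm_norm, inv_mul_cancel₀ (norm_ne_zero_iff.2 ha)]
    · rw [smul_smul, mul_inv_cancel₀ (norm_ne_zero_iff.2 ha), one_smul]

theorem norm_smul_add_dil_bounds {u : En n} (hu : ‖u‖ = 1) {s δ : ℝ} (hs : 0 ≤ s)
    (hδ : 0 < δ) (hsδ : s + 4 * δ ^ 2 = 1) {z : En n} (hz : ‖z‖ < 1) :
    s - δ ^ 2 ≤ ‖s • u + dil u δ z‖ ∧ ‖s • u + dil u δ z‖ < 1 := by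
  have hin : ‖(inner ℂ u z : ℂ)‖ ≤ 1 := by
    have := norm_inner_le_norm (𝕜 := ℂ) u z
    rw [hu, one_mul] at this
    linarith
  have hδ2 : 0 < δ ^ 2 := by positivity
  have hinw : (inner ℂ u (s • u + dil u δ z) : ℂ) = s + (δ : ℂ) ^ 2 * inner ℂ u z := by
    rw [inner_add_right, inner_dil hu, ← Complex.coe_smul, inner_smul_right,
      inner_self_eq_norm_sq_to_K, hu]
    simp
  have hδi : ‖(δ : ℂ) ^ 2 * inner ℂ u z‖ ≤ δ ^ 2 := by
    rw [norm_mul, norm_pow, Complex.norm_real, Real.norm_eq_abs, sq_abs]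
    nlinarith
  constructor
  · have h1 := norm_inner_le_norm (𝕜 := ℂ) u (s • u + dil u δ z)
    rw [hu, one_mul, hinw] at h1
    have h2 := norm_sub_norm_le (s : ℂ) (-((δ : ℂ) ^ 2 * inner ℂ u z))
    rw [sub_neg_eq_add, norm_neg, Complex.norm_real, Real.norm_of_nonneg hs] at h2
    linarith
  · have h1 := @norm_add_sq ℂ _ _ _ _ (s • u) (dil u δ z)
    rw [norm_dil_sq hu, ← Complex.coe_smul, inner_smul_left, inner_dil hu, Complex.coe_smul,
      norm_smul, hu, mul_one, Real.norm_of_nonneg hs, Complex.conj_ofReal] at h1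
    have h2 : RCLike.re ((s : ℂ) * ((δ : ℂ) ^ 2 * inner ℂ u z)) ≤ s * δ ^ 2 := by
      refine (RCLike.re_le_norm _).trans ?_
      rw [norm_mul, Complex.norm_real, Real.norm_of_nonneg hs]
      gcongr
    have h3 : 0 ≤ ‖(inner ℂ u z : ℂ)‖ ^ 2 := by positivity
    have h4 : ‖z‖ ^ 2 < 1 := by nlinarith [norm_nonneg z]
    have h5 : ‖z‖ ^ 2 + (δ ^ 2 - 1) * ‖(inner ℂ u z : ℂ)‖ ^ 2 < 1 := by nlinarith
    have h6 : ‖s • u + dil u δ z‖ ^ 2 < 1 := by nlinarith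
    nlinarith [norm_nonneg (s • u + dil u δ z)]

theorem exists_growth_bound (hn : 1 ≤ n) {q : ℝ} (hq : 0 < q) :
    ∃ C : ℝ≥0∞, C ≠ ⊤ ∧ ∀ h : En n → ℂ, DifferentiableOn ℂ h (Bn n) → ∀ a ∈ Bn n,
      ENNReal.ofReal ((1 - ‖a‖) ^ n) * ‖h a‖ₑ ^ q ≤ C * hNorm n q h ^ q := by
  obtain ⟨κ, -, hκ, hpolar⟩ := lintegral_polar_sigmaS hn
  set V := volume (ball (0 : En n) 1) with hV
  have hV0 : V ≠ 0 := (measure_ball_pos _ _ one_pos).ne'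
  have hVt : V ≠ ⊤ := measure_ball_lt_top.ne
  refine ⟨ENNReal.ofReal (4 ^ n) * (V⁻¹ * (κ * 5)), by finiteness, fun h hh a ha => ?_⟩
  have ha1 : ‖a‖ < 1 := by simpa [Bn] using ha
  obtain ⟨u, hu, hau⟩ := exists_unit_smul_eq hn a
  set s := ‖a‖ with hs
  have hs0 : 0 ≤ s := norm_nonneg a
  set M := hNorm n q h ^ q with hM
  set δ := √((1 - s) / 4) with hδ
  have hδ2 : δ ^ 2 = (1 - s) / 4 := Real.sq_sqrt (by linarith)
  have hδ0 : 0 < δ := Real.sqrt_pos.2 (by linarith)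
  have hbd := fun z (hz : ‖z‖ < 1) =>
    norm_smul_add_dil_bounds hu hs0 hδ0 (by linarith : s + 4 * δ ^ 2 = 1) hz
  set W : Set (En n) := {w | s - δ ^ 2 ≤ ‖w‖} ∩ ball 0 1 with hW
  have hWm : MeasurableSet W :=
    (isClosed_le continuous_const continuous_norm).measurableSet.inter measurableSet_ball
  set F := W.indicator fun z => ‖h z‖ₑ ^ q with hF
  have hFm : Measurable F :=
    measurable_indicator_enorm_rpow hWm (hh.continuousOn.mono inter_subset_right) q
  have hd : DifferentiableOn ℂ (fun z => h (a + dil u δ z)) (ball 0 1) := by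
    refine hh.comp (fun z _ => ?_) fun z hz => ?_
    · have hd := (dil u δ).toContinuousLinearMap.differentiable.const_add a
      exact hd.differentiableAt.differentiableWithinAt
    · have := (hbd z (by simpa using hz)).2
      rw [← hau] at this
      simpa [Bn] using this
  have h1 := volume_ball_mul_enorm_rpow_le hd hq
  rw [map_zero, add_zero] at h1
  have h2 : ∫⁻ z in ball (0 : En n) 1, ‖h (a + dil u δ z)‖ₑ ^ q ≤ ∫⁻ z, F (a + dil u δ z) := by
    refine le_trans (setLIntegral_mono' measurableSet_ball fun z hz => ?_)
      (setLIntegral_le_lintegral (ball 0 1) _)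
    have hb := hbd z (by simpa using hz)
    rw [← hau] at hb
    have : a + dil u δ z ∈ W := ⟨hb.1, by simpa using hb.2⟩
    rw [hF, indicator_of_mem this]
  have h3 := lintegral_dil hu hδ0 (hFm.comp (measurable_const_add a))
  simp only [Function.comp_def] at h3
  rw [lintegral_add_left_eq_self F a] at h3
  have h4 : ∫⁻ z, F z ≤ κ * (ENNReal.ofReal (5 * δ ^ 2) * M) := by
    rw [hpolar F hFm]
    gcongr
    calc ∫⁻ r in Ioi (0 : ℝ), ENNReal.ofReal (r ^ (2 * n - 1)) * ∫⁻ ζ, F (r • ζ) ∂(sigmaS n)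
        ≤ ∫⁻ r in Ioi (0 : ℝ), (Ico (s - δ ^ 2) 1).indicator (fun _ => M) r := by
          refine setLIntegral_mono' measurableSet_Ioi fun r hr => ?_
          have hr0 : 0 < r := hr
          have hnorm : ∀ ζ : En n, ‖ζ‖ = 1 → ‖r • ζ‖ = r := fun ζ hζ => by
            rw [norm_smul, hζ, mul_one, Real.norm_of_nonneg hr0.le]
          by_cases hrI : r ∈ Ico (s - δ ^ 2) 1
          · rw [indicator_of_mem hrI]
            have hle1 : ENNReal.ofReal (r ^ (2 * n - 1)) ≤ 1 :=
              ENNReal.ofReal_le_one.2 (pow_le_one₀ hr0.le hrI.2.le)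
            calc _ ≤ 1 * ∫⁻ ζ, F (r • ζ) ∂(sigmaS n) := by gcongr
              _ ≤ ∫⁻ ζ, ‖h (r • ζ)‖ₑ ^ q ∂(sigmaS n) := by
                rw [one_mul]
                exact lintegral_mono fun ζ => indicator_le_self _ _ _
              _ ≤ M := lintegral_sphere_le_hNorm_rpow hq h ⟨hr0, hrI.2⟩
          · rw [indicator_of_notMem hrI]
            have : ∫⁻ ζ, F (r • ζ) ∂(sigmaS n) = 0 := by
              refine lintegral_eq_zero_of_ae_eq_zero ?_
              filter_upwards [ae_norm_eq_one_sigmaS] with ζ hζ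
              refine indicator_of_notMem (fun hmem => hrI ⟨?_, ?_⟩) _
              · simpa [hnorm ζ hζ] using hmem.1
              · simpa [hnorm ζ hζ] using hmem.2
            rw [this, mul_zero]
      _ ≤ ∫⁻ r, (Ico (s - δ ^ 2) 1).indicator (fun _ => M) r := setLIntegral_le_lintegral _ _
      _ = ENNReal.ofReal (5 * δ ^ 2) * M := by
          rw [lintegral_indicator measurableSet_Ico, setLIntegral_const, Real.volume_Ico, mul_comm]
          congr 2
          linarith
  have h5 : V * ‖h a‖ₑ ^ q * ENNReal.ofReal (δ ^ (2 * (n + 1))) ≤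
      κ * (ENNReal.ofReal (5 * δ ^ 2) * M) := by
    refine le_trans ?_ (h3 ▸ h4)
    rw [mul_comm]
    gcongr
    exact h1.trans h2
  have hpow : ENNReal.ofReal (δ ^ (2 * (n + 1))) =
      ENNReal.ofReal ((δ ^ 2) ^ n) * ENNReal.ofReal (δ ^ 2) := by
    rw [← ENNReal.ofReal_mul (by positivity), pow_mul, pow_succ]
  have h6 : ENNReal.ofReal (5 * δ ^ 2) = 5 * ENNReal.ofReal (δ ^ 2) := by
    rw [ENNReal.ofReal_mul (by norm_num)]; norm_num
  have hδne : ENNReal.ofReal (δ ^ 2) ≠ 0 := by simpa using hδ0.ne'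
  have h7 : V * (ENNReal.ofReal ((δ ^ 2) ^ n) * ‖h a‖ₑ ^ q) ≤ κ * 5 * M := by
    rw [← ENNReal.mul_le_mul_iff_left hδne ENNReal.ofReal_ne_top]
    rw [hpow, h6] at h5
    calc _ = _ := by ring
      _ ≤ _ := h5
      _ = _ := by ring
  have h8 : ENNReal.ofReal ((δ ^ 2) ^ n) * ‖h a‖ₑ ^ q ≤ V⁻¹ * (κ * 5 * M) := by
    rw [← ENNReal.div_eq_inv_mul]
    rw [ENNReal.le_div_iff_mul_le (.inl hV0) (.inl hVt), mul_comm]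
    exact h7
  have h9 : ENNReal.ofReal ((1 - s) ^ n) =
      ENNReal.ofReal (4 ^ n) * ENNReal.ofReal ((δ ^ 2) ^ n) := by
    rw [← ENNReal.ofReal_mul (by positivity), ← mul_pow, hδ2]
    congr 2
    ring
  rw [h9, mul_assoc, mul_assoc, mul_assoc (V⁻¹)]
  gcongr

end Growth

section TestFunctions

variable {n : ℕ}

/-- The test function `(1 - ⟨z, a⟩)^{-N}`. -/
def kern (N : ℕ) (a z : En n) : ℂ := ((1 - inner ℂ a z) ^ N)⁻¹

theorem one_sub_le_norm_one_sub_inner {a z : En n} (hz : ‖z‖ ≤ 1) :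
    1 - ‖a‖ ≤ ‖(1 - inner ℂ a z : ℂ)‖ := by
  have h1 := norm_inner_le_norm (𝕜 := ℂ) a z
  have h2 := norm_sub_norm_le (1 : ℂ) (inner ℂ a z)
  rw [norm_one] at h2
  nlinarith [norm_nonneg a]

theorem differentiableOn_kern (N : ℕ) {a : En n} (ha : ‖a‖ < 1) :
    DifferentiableOn ℂ (kern N a) (Bn n) := by
  intro z hz
  have hz1 : ‖z‖ < 1 := by simpa [Bn] using hz
  have hne : (1 - inner ℂ a z : ℂ) ≠ 0 := by
    rw [← norm_pos_iff]
    linarith [one_sub_le_norm_one_sub_inner (a := a) hz1.le]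
  have hd : DifferentiableAt ℂ (fun z : En n => (1 - inner ℂ a z : ℂ)) z :=
    (innerSL ℂ a).differentiableAt.const_sub 1
  exact ((hd.pow N).inv (pow_ne_zero _ hne)).differentiableWithinAt

theorem exists_lintegral_ball_kernel_bound {c : ℝ} (hc : 2 * n < c) :
    ∃ K : ℝ≥0∞, K ≠ ⊤ ∧ ∀ u : En n, ‖u‖ = 1 → ∀ ε ∈ Ioc (0 : ℝ) 1,
      ∫⁻ z in ball (0 : En n) 1, ENNReal.ofReal ((ε + ‖(1 - inner ℂ u z : ℂ)‖) ^ (-c)) ≤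
        ENNReal.ofReal (ε ^ (n + 1 - c)) * K := by
  have hfin := finite_integral_one_add_norm (E := En n) (μ := volume) (r := c)
    (by rw [finrank_real_En]; exact_mod_cast hc)
  have hc0 : 0 < c := lt_of_le_of_lt (by positivity) hc
  refine ⟨ENNReal.ofReal (2 ^ c) * ∫⁻ y : En n, ENNReal.ofReal ((1 + ‖y‖) ^ (-c)),
    ENNReal.mul_ne_top ENNReal.ofReal_ne_top hfin.ne, fun u hu ε hε => ?_⟩
  set δ := √ε with hδ
  have hδ2 : δ ^ 2 = ε := Real.sq_sqrt hε.1.le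
  have hδ0 : 0 < δ := Real.sqrt_pos.2 hε.1
  set Φ := (ball (0 : En n) 1).indicator
    fun z => ENNReal.ofReal ((ε + ‖(1 - inner ℂ u z : ℂ)‖) ^ (-c)) with hΦ
  have hΦm : Measurable Φ := by
    refine Measurable.indicator ?_ measurableSet_ball
    have : Continuous fun z : En n => ‖(1 - inner ℂ u z : ℂ)‖ := by fun_prop
    exact ((measurable_const.add this.measurable).pow_const _).ennreal_ofReal
  have h1 := lintegral_dil hu hδ0 (hΦm.comp (measurable_const_sub u))
  simp only [Function.comp_def] at h1
  rw [lintegral_sub_left_eq_self Φ u] at h1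
  rw [← lintegral_indicator measurableSet_ball, h1, pow_mul, hδ2]
  have h2 : ∫⁻ y, Φ (u - dil u δ y) ≤ ∫⁻ y : En n, ENNReal.ofReal (ε ^ (-c)) *
      (ENNReal.ofReal (2 ^ c) * ENNReal.ofReal ((1 + ‖y‖) ^ (-c))) := by
    refine lintegral_mono fun y => ?_
    rw [hΦ]
    by_cases hy : u - dil u δ y ∈ ball (0 : En n) 1
    · rw [indicator_of_mem hy, ← ENNReal.ofReal_mul (by positivity),
        ← ENNReal.ofReal_mul (by have := hε.1; positivity)]
      refine ENNReal.ofReal_le_ofReal ?_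
      set b : ℂ := inner ℂ u y with hb
      have hin : (1 - inner ℂ u (u - dil u δ y) : ℂ) = ε * b := by
        rw [inner_sub_right, inner_dil hu, inner_self_eq_norm_sq_to_K, hu, ← Complex.ofReal_pow,
          hδ2]
        simp [hb]
      have hns := @norm_sub_sq ℂ _ _ _ _ u (dil u δ y)
      rw [norm_dil_sq hu, inner_dil hu, hu, hδ2, ← Complex.ofReal_pow, hδ2, ← hb] at hns
      have hlt : ‖u - dil u δ y‖ < 1 := by simpa using hy
      have hlt2 : ‖u - dil u δ y‖ ^ 2 < 1 := by nlinarith [norm_nonneg (u - dil u δ y)]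
      have hre : RCLike.re ((ε : ℂ) * b) ≤ ε * ‖b‖ := by
        refine (RCLike.re_le_norm _).trans ?_
        rw [norm_mul, Complex.norm_real, Real.norm_of_nonneg hε.1.le]
      have hε0 := hε.1
      have h3 : ε * (‖y‖ ^ 2 + (ε - 1) * ‖b‖ ^ 2) < ε * (2 * ‖b‖) := by nlinarith
      have h4 := lt_of_mul_lt_mul_left h3 hε0.le
      have h5 : ‖y‖ ≤ 1 + ‖b‖ := by
        refine abs_le_of_sq_le_sq' ?_ (by positivity) |>.2
        nlinarith [sq_nonneg ‖b‖]
      rw [hin, norm_mul, Complex.norm_real, Real.norm_of_nonneg hε0.le]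
      have h6 : ε * ((1 + ‖y‖) / 2) ≤ ε + ε * ‖b‖ := by
        have := mul_le_mul_of_nonneg_left
          (show (1 + ‖y‖) / 2 ≤ 1 + ‖b‖ by linarith [norm_nonneg b]) hε0.le
        linarith
      refine (Real.rpow_le_rpow_of_nonpos (by positivity) h6 (by linarith)).trans_eq ?_
      rw [Real.mul_rpow hε0.le (by positivity), Real.div_rpow (by positivity) (by norm_num),
        Real.rpow_neg (by norm_num : (0:ℝ) ≤ 2), div_inv_eq_mul]
      ring
    · rw [indicator_of_notMem hy]
      exact zero_le
  refine (mul_le_mul_right h2 _).trans_eq ?_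
  rw [lintegral_const_mul' _ _ ENNReal.ofReal_ne_top,
    lintegral_const_mul' _ _ ENNReal.ofReal_ne_top,
    ← mul_assoc, ← ENNReal.ofReal_mul (by have := hε.1; positivity)]
  congr 2
  rw [sub_eq_add_neg, Real.rpow_add hε.1]
  norm_cast

theorem exists_hNorm_kern_bound (hn : 1 ≤ n) {p : ℝ} (hp : 0 < p) {N : ℕ} (hN : 2 * n < N * p) :
    ∃ K : ℝ≥0∞, K ≠ ⊤ ∧ ∀ u : En n, ‖u‖ = 1 → ∀ ε ∈ Ioc (0 : ℝ) (1 / 2),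
      hNorm n p (kern N ((1 - ε) • u)) ^ p ≤ ENNReal.ofReal (ε ^ (n - N * p)) * K := by
  set c := N * p with hc
  have hc0 : 0 < c := lt_of_le_of_lt (by positivity) hN
  obtain ⟨K, hK, hball⟩ := exists_lintegral_ball_kernel_bound (n := n) hN
  obtain ⟨κ, hκ0, hκ, hpolar⟩ := lintegral_polar_sigmaS hn
  refine ⟨ENNReal.ofReal (2 ^ (2 * n - 1) * 4 ^ c) * (κ⁻¹ * K), by finiteness, fun u hu ε hε => ?_⟩
  have hε0 := hε.1
  have hε2 := hε.2
  rw [hNorm, ← ENNReal.rpow_mul, one_div_mul_cancel hp.ne', ENNReal.rpow_one]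
  refine iSup₂_le fun r hr => ?_
  set I := ∫⁻ ζ, (‖kern N ((1 - ε) • u) (r • ζ)‖₊ : ℝ≥0∞) ^ p ∂(sigmaS n) with hI
  set Φ := (ball (0 : En n) 1).indicator
    fun z => ENNReal.ofReal ((ε + ‖(1 - inner ℂ u z : ℂ)‖) ^ (-c)) with hΦ
  have hΦm : Measurable Φ := by
    refine Measurable.indicator ?_ measurableSet_ball
    have : Continuous fun z : En n => ‖(1 - inner ℂ u z : ℂ)‖ := by fun_prop
    exact ((measurable_const.add this.measurable).pow_const _).ennreal_ofReal
  have hle := hball u hu ε ⟨hε0, by linarith⟩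
  rw [← lintegral_indicator measurableSet_ball, hpolar Φ hΦm] at hle
  have hpt : ∀ t ∈ Ioo (1 - ε) 1, ∀ ζ : En n, ‖ζ‖ = 1 →
      (‖kern N ((1 - ε) • u) (r • ζ)‖₊ : ℝ≥0∞) ^ p ≤ ENNReal.ofReal (4 ^ c) * Φ (t • ζ) := by
    intro t ht ζ hζ
    have ht0 : 0 < t := by linarith [ht.1]
    have hmem : t • ζ ∈ ball (0 : En n) 1 := by
      simpa [norm_smul, hζ, abs_of_pos ht0] using ht.2
    rw [hΦ, indicator_of_mem hmem]
    set w : ℂ := inner ℂ u ζ with hw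
    have hw1 : ‖w‖ ≤ 1 := by
      have := norm_inner_le_norm (𝕜 := ℂ) u ζ
      rwa [hu, hζ, one_mul] at this
    have e1 : (1 - inner ℂ u (t • ζ) : ℂ) = 1 - t * w := by
      rw [← Complex.coe_smul, inner_smul_right]
    have e2 : (1 - inner ℂ ((1 - ε) • u) (r • ζ) : ℂ) = 1 - ((1 - ε) * r : ℝ) * w := by
      rw [← Complex.coe_smul, ← Complex.coe_smul r, inner_smul_right, inner_smul_left,
        Complex.conj_ofReal]
      push_cast
      ring
    set x := ‖(1 - ((1 - ε) * r : ℝ) * w : ℂ)‖ with hx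
    have hτ1 : (1 - ε) * r ≤ 1 - ε := by nlinarith [hr.1, hr.2]
    have hτ0 : 0 ≤ (1 - ε) * r := mul_nonneg (by linarith) hr.1.le
    have hxτ : 1 - (1 - ε) * r ≤ x := by
      have := norm_sub_norm_le (1 : ℂ) (((1 - ε) * r : ℝ) * w)
      rw [norm_one, norm_mul, Complex.norm_real, Real.norm_of_nonneg hτ0] at this
      nlinarith
    have hdiff : ‖(1 - t * w : ℂ)‖ ≤ x + ((1 - (1 - ε) * r) + (1 - t)) := by
      have e3 : (1 - t * w : ℂ) = (1 - ((1 - ε) * r : ℝ) * w) +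
          ((((1 - ε) * r - 1 + (1 - t) : ℝ)) * w) := by push_cast; ring
      rw [e3]
      refine (norm_add_le _ _).trans ?_
      gcongr
      rw [norm_mul, Complex.norm_real]
      refine (mul_le_of_le_one_right (norm_nonneg _) hw1).trans ?_
      rw [Real.norm_eq_abs, abs_le]
      constructor <;> linarith [ht.1, ht.2]
    have hx0 : 0 < x := by linarith
    have hbase : ε + ‖(1 - t * w : ℂ)‖ ≤ 4 * x := by linarith [ht.1]
    have hk : ((‖kern N ((1 - ε) • u) (r • ζ)‖₊ : ℝ≥0∞)) = ENNReal.ofReal (x ^ (-(N : ℝ))) := by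
      rw [← enorm_eq_nnnorm, ← ofReal_norm, kern, norm_inv, norm_pow, e2, Real.rpow_neg hx0.le,
        Real.rpow_natCast]
    rw [hk, ENNReal.ofReal_rpow_of_nonneg (by positivity) hp.le, ← Real.rpow_mul hx0.le, e1,
      ← ENNReal.ofReal_mul (by positivity), neg_mul, ← hc]
    refine ENNReal.ofReal_le_ofReal ?_
    have := Real.rpow_le_rpow_of_nonpos (by positivity) hbase (by linarith : -c ≤ 0)
    rw [Real.mul_rpow (by norm_num) hx0.le, Real.rpow_neg (by norm_num : (0:ℝ) ≤ 4)] at this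
    rw [← inv_mul_le_iff₀ (by positivity)]
    exact this
  have hci : ENNReal.ofReal ε * ((ENNReal.ofReal (2 ^ (2 * n - 1)))⁻¹ * I) ≤
      ENNReal.ofReal (4 ^ c) * ∫⁻ t in Ioi (0 : ℝ), ENNReal.ofReal (t ^ (2 * n - 1)) *
        ∫⁻ ζ, Φ (t • ζ) ∂(sigmaS n) := by
    rw [← lintegral_const_mul' _ _ ENNReal.ofReal_ne_top]
    calc ENNReal.ofReal ε * ((ENNReal.ofReal (2 ^ (2 * n - 1)))⁻¹ * I)
        = ∫⁻ t in Ioo (1 - ε) 1, (ENNReal.ofReal (2 ^ (2 * n - 1)))⁻¹ * I := by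
          rw [setLIntegral_const, Real.volume_Ioo, mul_comm]
          congr 2
          ring
      _ ≤ ∫⁻ t in Ioo (1 - ε) 1, ENNReal.ofReal (4 ^ c) * (ENNReal.ofReal (t ^ (2 * n - 1)) *
            ∫⁻ ζ, Φ (t • ζ) ∂(sigmaS n)) := by
          refine setLIntegral_mono' measurableSet_Ioo fun t ht => ?_
          have h1 : I ≤ ENNReal.ofReal (4 ^ c) * ∫⁻ ζ, Φ (t • ζ) ∂(sigmaS n) := by
            rw [← lintegral_const_mul' _ _ ENNReal.ofReal_ne_top]
            refine lintegral_mono_ae ?_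
            filter_upwards [ae_norm_eq_one_sigmaS] with ζ hζ using hpt t ht ζ hζ
          have h2 : (ENNReal.ofReal (2 ^ (2 * n - 1)))⁻¹ ≤ ENNReal.ofReal (t ^ (2 * n - 1)) := by
            rw [← ENNReal.ofReal_inv_of_pos (by positivity), ← inv_pow]
            refine ENNReal.ofReal_le_ofReal (pow_le_pow_left₀ (by norm_num) ?_ _)
            linarith [ht.1]
          calc _ ≤ _ := mul_le_mul' h2 h1
            _ = _ := by ring
      _ ≤ _ := lintegral_mono_set fun t ht => by
          have := ht.1
          simp only [mem_Ioi]
          linarith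
  have hκint : ∀ X : ℝ≥0∞, κ * X ≤ ENNReal.ofReal (ε ^ (n + 1 - c)) * K →
      X ≤ κ⁻¹ * (ENNReal.ofReal (ε ^ (n + 1 - c)) * K) := fun X hX => by
    rw [← ENNReal.div_eq_inv_mul, ENNReal.le_div_iff_mul_le (.inl hκ0) (.inl hκ), mul_comm]
    exact hX
  have hfinal := hci.trans (mul_le_mul_right (hκint _ hle) _)
  have he : ENNReal.ofReal (ε ^ (n + 1 - c)) =
      ENNReal.ofReal ε * ENNReal.ofReal (ε ^ (n - c)) := by
    rw [← ENNReal.ofReal_mul hε0.le, add_sub_right_comm, Real.rpow_add hε0, Real.rpow_one,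
      mul_comm]
  have hεne : ENNReal.ofReal ε ≠ 0 := by simpa using hε0
  have h2ne : ENNReal.ofReal (2 ^ (2 * n - 1) : ℝ) ≠ 0 := by simp
  have h10 : (ENNReal.ofReal (2 ^ (2 * n - 1)))⁻¹ * I ≤
      ENNReal.ofReal (4 ^ c) * (κ⁻¹ * (ENNReal.ofReal (ε ^ (n - c)) * K)) := by
    rw [← ENNReal.mul_le_mul_iff_right hεne ENNReal.ofReal_ne_top]
    refine hfinal.trans_eq ?_
    rw [he]
    ring
  rw [← ENNReal.div_eq_inv_mul, ENNReal.div_le_iff h2ne ENNReal.ofReal_ne_top] at h10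
  refine h10.trans_eq ?_
  rw [ENNReal.ofReal_mul (by positivity)]
  ring

end TestFunctions

section ParametricIntegral

variable {E Ω : Type*} [NormedAddCommGroup E] [NormedSpace ℂ E] [FiniteDimensional ℂ E]
  [MeasurableSpace Ω] {μ : Measure Ω}

theorem aestronglyMeasurable_fderiv_param {F : E → Ω → ℂ} {z₀ : E} {r : ℝ} (hr : 0 < r)
    (hd : ∀ᵐ ω ∂μ, DifferentiableOn ℂ (F · ω) (ball z₀ r))
    (hm : ∀ z ∈ ball z₀ r, AEStronglyMeasurable (F z) μ) :
    AEStronglyMeasurable (fun ω => fderiv ℂ (F · ω) z₀) μ := by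
  have happ : ∀ v : E, AEStronglyMeasurable (fun ω => fderiv ℂ (F · ω) z₀ v) μ := by
    intro v
    set c : ℕ → ℂ := fun k => (((k + 1) * ((‖v‖ + 1) / r) : ℝ) : ℂ) with hc
    have hpos : ∀ k : ℕ, 0 < (k + 1) * ((‖v‖ + 1) / r) := fun k => by positivity
    have hnorm : ∀ k, ‖c k‖ = (k + 1) * ((‖v‖ + 1) / r) := fun k => by
      rw [hc, Complex.norm_real, Real.norm_of_nonneg (hpos k).le]
    have hmem : ∀ k, z₀ + (c k)⁻¹ • v ∈ ball z₀ r := by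
      intro k
      rw [mem_ball_iff_norm, add_sub_cancel_left, norm_smul, norm_inv, hnorm,
        inv_mul_lt_iff₀ (hpos k)]
      have : (k + 1) * ((‖v‖ + 1) / r) * r = (k + 1) * (‖v‖ + 1) := by field_simp
      rw [this]
      nlinarith [norm_nonneg v, (Nat.cast_nonneg k : (0 : ℝ) ≤ k)]
    have hctop : Tendsto (fun k => ‖c k‖) atTop atTop := by
      simp_rw [hnorm]
      exact (tendsto_atTop_add_const_right _ _ tendsto_natCast_atTop_atTop).atTop_mul_const
        (by positivity)
    refine aestronglyMeasurable_of_tendsto_ae atTop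
      (f := fun k ω => c k • (F (z₀ + (c k)⁻¹ • v) ω - F z₀ ω)) (fun k => ?_) ?_
    · exact ((hm _ (hmem k)).sub (hm _ (mem_ball_self hr))).const_smul (c k)
    · filter_upwards [hd] with ω hω
      exact ((hω.differentiableAt (ball_mem_nhds _ hr)).hasFDerivAt).lim v hctop
  set b := Module.finBasis ℂ E
  have hsum : (fun ω => fderiv ℂ (F · ω) z₀) = fun ω => ∑ i,
      fderiv ℂ (F · ω) z₀ (b i) • LinearMap.toContinuousLinearMap (b.coord i) := by
    funext ω
    ext v
    have h := congrArg (fderiv ℂ (F · ω) z₀) (b.sum_repr v)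
    simp only [map_sum, map_smul, smul_eq_mul] at h
    rw [← h]
    simp [mul_comm]
  rw [hsum]
  exact Finset.aestronglyMeasurable_fun_sum _ fun i _ => (happ (b i)).smul_const _

theorem differentiableAt_integral_of_norm_le [IsFiniteMeasure μ] {F : E → Ω → ℂ} {z₀ : E}
    {r C : ℝ} (hr : 0 < r) (hd : ∀ᵐ ω ∂μ, DifferentiableOn ℂ (F · ω) (ball z₀ r))
    (hb : ∀ᵐ ω ∂μ, ∀ z ∈ ball z₀ r, ‖F z ω‖ ≤ C)
    (hm : ∀ z ∈ ball z₀ r, AEStronglyMeasurable (F z) μ) :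
    DifferentiableAt ℂ (fun z => ∫ ω, F z ω ∂μ) z₀ := by
  have hz₀ := mem_ball_self (x := z₀) hr
  refine (hasFDerivAt_integral_of_dominated_loc_of_lip' (bound := fun _ => 2 * C / r)
    (ball_mem_nhds z₀ hr) hm ?_ (aestronglyMeasurable_fderiv_param hr hd hm) ?_
    (integrable_const _) ?_).2.differentiableAt
  · exact Integrable.of_bound (hm z₀ hz₀) C (hb.mono fun ω h => h z₀ hz₀)
  · filter_upwards [hd, hb] with ω hω hbω z hz
    rw [← dist_eq_norm, ← dist_eq_norm]
    refine Complex.dist_le_div_mul_dist_of_mapsTo_ball hω (fun w hw => ?_) hz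
    rw [mem_closedBall, dist_eq_norm]
    exact (norm_sub_le _ _).trans (by linarith [hbω w hw, hbω z₀ hz₀])
  · filter_upwards [hd] with ω hω
    exact (hω.differentiableAt (ball_mem_nhds _ hr)).hasFDerivAt

end ParametricIntegral

section RadialPrimitive

variable {n : ℕ}

theorem exists_norm_le_of_continuousOn_Bn {f : En n → ℂ} (hf : ContinuousOn f (Bn n)) {R : ℝ}
    (hR : R < 1) : ∃ C : ℝ, ∀ z, ‖z‖ ≤ R → ‖f z‖ ≤ C := by
  obtain ⟨C, hC⟩ := (isCompact_closedBall (0 : En n) R).exists_bound_of_continuousOn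
    (hf.mono (closedBall_subset_ball hR))
  exact ⟨C, fun z hz => hC z (by simpa using hz)⟩

theorem radD_eq_deriv {g : En n → ℂ} {z : En n} (hg : DifferentiableAt ℂ g z) :
    radD g z = deriv (fun l : ℂ => g (z + l • z)) 0 := by
  have h1 : HasDerivAt (fun l : ℂ => z + l • z) z 0 := by
    simpa using ((hasDerivAt_id (0 : ℂ)).smul_const z).const_add z
  have h2 : HasFDerivAt g (fderiv ℂ g z) (z + (0 : ℂ) • z) := by simpa using hg.hasFDerivAt
  exact (h2.comp_hasDerivAt 0 h1).deriv.symm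

theorem differentiableOn_radD {g : En n → ℂ} (hg : DifferentiableOn ℂ g (Bn n)) :
    DifferentiableOn ℂ (radD g) (Bn n) := by
  intro z₀ hz₀
  refine DifferentiableAt.differentiableWithinAt ?_
  have hz₀1 : ‖z₀‖ < 1 := by simpa [Bn] using hz₀
  set r := (1 - ‖z₀‖) / 4 with hr
  have hr0 : 0 < r := by linarith
  have hR : ‖z₀‖ + 2 * r < 1 := by linarith
  obtain ⟨M, hM⟩ := exists_norm_le_of_continuousOn_Bn hg.continuousOn hR
  have hnear : ∀ z ∈ ball z₀ r, ∀ l : ℂ, ‖l‖ ≤ r → ‖z + l • z‖ ≤ ‖z₀‖ + 2 * r := by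
    intro z hz l hl
    have h1 : ‖z‖ < ‖z₀‖ + r := by
      have := norm_sub_norm_le z z₀
      rw [mem_ball_iff_norm] at hz
      linarith
    have h2 := norm_add_le z (l • z)
    rw [norm_smul] at h2
    have h3 : ‖l‖ * ‖z‖ ≤ r * 1 := by gcongr; linarith
    linarith
  have hmem : ∀ z ∈ ball z₀ r, ∀ l : ℂ, ‖l‖ ≤ r → z + l • z ∈ Bn n := fun z hz l hl => by
    simpa [Bn] using (hnear z hz l hl).trans_lt hR
  set F : En n → ℝ → ℂ := fun z θ => deriv (circleMap 0 r) θ •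
    ((circleMap 0 r θ - 0) ^ 2)⁻¹ • g (z + circleMap 0 r θ • z) with hF
  have hcm : ∀ θ, ‖circleMap 0 r θ‖ = r := fun θ => by simp [abs_of_pos hr0]
  have heq : radD g =ᶠ[𝓝 z₀] fun z =>
      (2 * Real.pi * Complex.I : ℂ)⁻¹ • ∫ θ in Ioc 0 (2 * Real.pi), F z θ := by
    filter_upwards [ball_mem_nhds z₀ hr0] with z hz
    have hzB : z ∈ Bn n := by simpa using hmem z hz 0 (by simpa using hr0.le)
    rw [radD_eq_deriv (hg.differentiableAt (isOpen_ball.mem_nhds hzB))]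
    have hU : IsOpen {l : ℂ | z + l • z ∈ Bn n} := isOpen_ball.preimage (by fun_prop)
    have hd : DifferentiableOn ℂ (fun l : ℂ => g (z + l • z)) {l : ℂ | z + l • z ∈ Bn n} :=
      hg.comp (by fun_prop) fun l hl => hl
    rw [← Complex.two_pi_I_inv_smul_circleIntegral_sub_sq_inv_smul_of_differentiable hU
      (fun l hl => hmem z hz l (by simpa using hl)) hd (mem_ball_self hr0), circleIntegral,
      intervalIntegral.integral_of_le (by positivity)]
  have hD : DifferentiableAt ℂ (fun z => ∫ θ in Ioc 0 (2 * Real.pi), F z θ) z₀ := by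
    refine differentiableAt_integral_of_norm_le (C := r * ((r ^ 2)⁻¹ * M)) hr0
      (Eventually.of_forall fun θ => ?_) (Eventually.of_forall fun θ z hz => ?_) fun z hz => ?_
    · refine DifferentiableOn.fun_const_smul (DifferentiableOn.fun_const_smul ?_ _) _
      exact hg.comp (by fun_prop) fun z hz => hmem z hz _ (hcm θ).le
    · rw [hF]
      simp only [norm_smul, deriv_circleMap, norm_mul, Complex.norm_I, mul_one, norm_inv, norm_pow,
        sub_zero, hcm]
      gcongr
      exact hM _ (hnear z hz _ (hcm θ).le)
    · refine Continuous.aestronglyMeasurable ?_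
      have h1 : Continuous fun θ => g (z + circleMap 0 r θ • z) :=
        hg.continuousOn.comp_continuous (by fun_prop) fun θ => hmem z hz _ (hcm θ).le
      have h2 : Continuous fun θ => ((circleMap 0 r θ - 0) ^ 2)⁻¹ := by
        refine Continuous.inv₀ (by fun_prop) fun θ => ?_
        rw [sub_zero, ← norm_pos_iff, norm_pow, hcm]
        positivity
      simp only [hF, deriv_circleMap]
      exact (by fun_prop : Continuous fun θ => circleMap 0 r θ * Complex.I).smul (h2.smul h1)
  exact (hD.fun_const_smul _).congr_of_eventuallyEq heq

theorem exists_norm_le_mul_norm {G : En n → ℂ} (hG : DifferentiableOn ℂ G (Bn n))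
    (hG0 : G 0 = 0) {R : ℝ} (hR : R < 1) :
    ∃ C : ℝ, ∀ z, ‖z‖ < R → ‖G z‖ ≤ C * ‖z‖ := by
  obtain ⟨M, hM⟩ := exists_norm_le_of_continuousOn_Bn hG.continuousOn hR
  refine ⟨M / R, fun z hz => ?_⟩
  have h := Complex.dist_le_div_mul_dist_of_mapsTo_ball (c := (0 : En n)) (z := z) (R₁ := R)
    (R₂ := M) (hG.mono (ball_subset_ball hR.le)) (fun w hw => ?_) (by simpa using hz)
  · simpa [hG0] using h
  · simpa [hG0] using hM w (by simpa using (mem_ball.1 hw).le)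

theorem smul_mem_Bn {z : En n} (hz : ‖z‖ < 1) {t : ℝ} (ht : t ∈ Ioo (0 : ℝ) 1) :
    t • z ∈ Bn n := by
  have : ‖t • z‖ < 1 := by
    rw [norm_smul, Real.norm_of_nonneg ht.1.le]
    nlinarith [norm_nonneg z, ht.1, ht.2]
  simpa [Bn] using this

theorem continuousOn_radial_quotient {G : En n → ℂ} (hG : ContinuousOn G (Bn n)) (z : En n)
    {S : Set ℝ} (hS : ∀ t ∈ S, 0 < t ∧ t • z ∈ Bn n) :
    ContinuousOn (fun t : ℝ => G (t • z) / (t : ℂ)) S := by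
  refine (hG.comp (by fun_prop) fun t ht => (hS t ht).2).div (by fun_prop) fun t ht => ?_
  exact_mod_cast (hS t ht).1.ne'

theorem differentiableOn_radial_primitive {G : En n → ℂ} (hG : DifferentiableOn ℂ G (Bn n))
    (hG0 : G 0 = 0) :
    DifferentiableOn ℂ (fun z => ∫ t in Ioo (0 : ℝ) 1, G (t • z) / (t : ℂ)) (Bn n) := by
  intro z₀ hz₀
  refine DifferentiableAt.differentiableWithinAt ?_
  have hz₀1 : ‖z₀‖ < 1 := by simpa [Bn] using hz₀
  set r := (1 - ‖z₀‖) / 2 with hr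
  have hr0 : 0 < r := by linarith
  obtain ⟨C, hC⟩ := exists_norm_le_mul_norm hG hG0 (R := ‖z₀‖ + r) (by linarith)
  have hnear : ∀ z ∈ ball z₀ r, ‖z‖ < ‖z₀‖ + r := fun z hz => by
    have := norm_sub_norm_le z z₀
    rw [mem_ball_iff_norm] at hz
    linarith
  have hnear1 : ∀ z ∈ ball z₀ r, ‖z‖ < 1 := fun z hz => (hnear z hz).trans (by linarith)
  refine differentiableAt_integral_of_norm_le (C := |C|) hr0 ?_ ?_ fun z hz => ?_
  · filter_upwards [ae_restrict_mem measurableSet_Ioo] with t ht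
    simp only [div_eq_mul_inv]
    refine DifferentiableOn.mul_const ?_ _
    refine hG.comp (Differentiable.differentiableOn ?_) fun z hz => smul_mem_Bn (hnear1 z hz) ht
    exact (differentiable_id.const_smul t)
  · filter_upwards [ae_restrict_mem measurableSet_Ioo] with t ht z hz
    have ht0 := ht.1
    have hn : ‖t • z‖ = t * ‖z‖ := by rw [norm_smul, Real.norm_of_nonneg ht.1.le]
    have hlt : ‖t • z‖ < ‖z₀‖ + r := by
      rw [hn]
      nlinarith [norm_nonneg z, hnear z hz, ht.1, ht.2]
    rw [norm_div, Complex.norm_real, Real.norm_of_nonneg ht.1.le, div_le_iff₀ ht.1]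
    refine (hC _ hlt).trans ?_
    rw [hn]
    calc C * (t * ‖z‖) ≤ |C| * (t * 1) := by
          gcongr
          · exact le_abs_self C
          · exact (hnear1 z hz).le
      _ = |C| * t := by rw [mul_one]
  · exact (continuousOn_radial_quotient hG.continuousOn z fun t ht =>
      ⟨ht.1, smul_mem_Bn (hnear1 z hz) ht⟩).aestronglyMeasurable measurableSet_Ioo

theorem deriv_radial_primitive {G : En n → ℂ} (hG : DifferentiableOn ℂ G (Bn n))
    (hG0 : G 0 = 0) {a : En n} (ha : a ∈ Bn n) :
    deriv (fun l : ℂ => ∫ t in Ioo (0 : ℝ) 1, G (t • l • a) / (t : ℂ)) 1 = G a := by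
  have ha1 : ‖a‖ < 1 := by simpa [Bn] using ha
  set φ : ℝ → ℂ := fun t => G (t • a) / (t : ℂ) with hφ
  have hdiff : DifferentiableAt ℂ
      (fun l : ℂ => ∫ t in Ioo (0 : ℝ) 1, G (t • l • a) / (t : ℂ)) ((1 : ℝ) : ℂ) := by
    have h1 := (differentiableOn_radial_primitive hG hG0).differentiableAt
      (isOpen_ball.mem_nhds (show (1 : ℂ) • a ∈ Bn n by simpa using ha))
    rw [Complex.ofReal_one]
    exact DifferentiableAt.comp (g := fun z => ∫ t in Ioo (0 : ℝ) 1, G (t • z) / (t : ℂ))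
      (f := fun l : ℂ => l • a) (1 : ℂ) h1 (by fun_prop)
  have hreal := hdiff.hasDerivAt.comp_ofReal
  have hopen : IsOpen {t : ℝ | 0 < t ∧ t • a ∈ Bn n} :=
    (isOpen_lt continuous_const continuous_id).inter (isOpen_ball.preimage (by fun_prop))
  have hφc : ContinuousOn φ {t : ℝ | 0 < t ∧ t • a ∈ Bn n} :=
    continuousOn_radial_quotient hG.continuousOn a fun t ht => ht
  have h1mem : (1 : ℝ) ∈ {t : ℝ | 0 < t ∧ t • a ∈ Bn n} := ⟨one_pos, by simpa using ha⟩
  obtain ⟨C, hC⟩ := exists_norm_le_mul_norm hG hG0 (R := (‖a‖ + 1) / 2)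
    (by linarith)
  have hci : IntervalIntegrable φ volume 0 1 := by
    rw [intervalIntegrable_iff_integrableOn_Ioo_of_le zero_le_one]
    refine Integrable.of_bound
      ((hφc.mono fun t ht => ⟨ht.1, smul_mem_Bn ha1 ht⟩).aestronglyMeasurable
        measurableSet_Ioo) |C| ?_
    filter_upwards [ae_restrict_mem measurableSet_Ioo] with t ht
    have ht0 := ht.1
    have hn : ‖t • a‖ = t * ‖a‖ := by rw [norm_smul, Real.norm_of_nonneg ht.1.le]
    have hlt : ‖t • a‖ < (‖a‖ + 1) / 2 := by
      rw [hn]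
      nlinarith [norm_nonneg a, ht.1, ht.2]
    rw [hφ, norm_div, Complex.norm_real, Real.norm_of_nonneg ht.1.le, div_le_iff₀ ht.1]
    refine (hC _ hlt).trans ?_
    rw [hn]
    calc C * (t * ‖a‖) ≤ |C| * (t * 1) := by
          gcongr
          exact le_abs_self C
      _ = |C| * t := by rw [mul_one]
  have hftc := intervalIntegral.integral_hasDerivAt_right hci
    (hφc.stronglyMeasurableAtFilter hopen 1 h1mem) (hφc.continuousAt (hopen.mem_nhds h1mem))
  have heq : (fun x : ℝ => ∫ t in Ioo (0 : ℝ) 1, G (t • (x : ℂ) • a) / (t : ℂ)) =ᶠ[𝓝 1]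
      fun x => ∫ t in (0 : ℝ)..x, φ t := by
    filter_upwards [lt_mem_nhds one_pos] with x hx
    have h1 := intervalIntegral.smul_integral_comp_mul_right φ (a := 0) (b := 1) x
    rw [zero_mul, one_mul, intervalIntegral.integral_of_le zero_le_one,
      integral_Ioc_eq_integral_Ioo, ← integral_smul] at h1
    rw [← h1]
    refine setIntegral_congr_fun measurableSet_Ioo fun t ht => ?_
    have hx' : (x : ℂ) ≠ 0 := by exact_mod_cast hx.ne'
    have ht' : (t : ℂ) ≠ 0 := by exact_mod_cast ht.1.ne'
    simp only [hφ, Complex.coe_smul, smul_smul, Complex.ofReal_mul, Complex.real_smul]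
    field_simp
  have := hreal.unique (hftc.congr_of_eventuallyEq heq)
  rw [Complex.ofReal_one] at this
  rw [this, hφ]
  simp

end RadialPrimitive

section Volterra

variable {n : ℕ}

theorem differentiableOn_J {g f : En n → ℂ} (hg : DifferentiableOn ℂ g (Bn n))
    (hf : DifferentiableOn ℂ f (Bn n)) : DifferentiableOn ℂ (J g f) (Bn n) :=
  differentiableOn_radial_primitive (G := fun z => f z * radD g z)
    (hf.mul (differentiableOn_radD hg)) (by simp [radD])

theorem deriv_J {g f : En n → ℂ} (hg : DifferentiableOn ℂ g (Bn n))
    (hf : DifferentiableOn ℂ f (Bn n)) {a : En n} (ha : a ∈ Bn n) :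
    deriv (fun l : ℂ => J g f (l • a)) 1 = f a * radD g a :=
  deriv_radial_primitive (G := fun z => f z * radD g z)
    (hf.mul (differentiableOn_radD hg)) (by simp [radD]) ha

theorem exists_norm_le_hNorm (hn : 1 ≤ n) {q : ℝ} (hq : 0 < q) :
    ∃ C : ℝ, 0 ≤ C ∧ ∀ h : En n → ℂ, MemHp n q h → ∀ a ∈ Bn n,
      ‖h a‖ ≤ C * (1 - ‖a‖) ^ (-(n / q)) * (hNorm n q h).toReal := by
  obtain ⟨C, hC, hgrow⟩ := exists_growth_bound hn hq
  refine ⟨C.toReal ^ (1 / q), by positivity, fun h hh a ha => ?_⟩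
  have ha1 : ‖a‖ < 1 := by simpa [Bn] using ha
  have hx : 0 < 1 - ‖a‖ := by linarith
  have h1 := ENNReal.toReal_mono
    (ENNReal.mul_ne_top hC (ENNReal.rpow_ne_top_of_nonneg hq.le hh.2.ne)) (hgrow h hh.1 a ha)
  rw [ENNReal.toReal_mul, ENNReal.toReal_mul, ← ENNReal.toReal_rpow, ← ENNReal.toReal_rpow,
    toReal_enorm, ENNReal.toReal_ofReal (by positivity)] at h1
  have h2 : ‖h a‖ ^ q ≤ C.toReal * (1 - ‖a‖) ^ (-(n : ℝ)) * (hNorm n q h).toReal ^ q := by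
    rw [Real.rpow_neg hx.le, Real.rpow_natCast, mul_right_comm, ← div_eq_mul_inv,
      le_div_iff₀ (by positivity), mul_comm]
    exact h1
  have h3 := Real.rpow_le_rpow (by positivity) h2 (one_div_nonneg.2 hq.le)
  rw [← Real.rpow_mul (norm_nonneg _), mul_one_div_cancel hq.ne', Real.rpow_one,
    Real.mul_rpow (by positivity) (by positivity), Real.mul_rpow (by positivity) (by positivity),
    ← Real.rpow_mul hx.le, ← Real.rpow_mul ENNReal.toReal_nonneg, mul_one_div_cancel hq.ne',
    Real.rpow_one] at h3
  refine h3.trans_eq ?_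
  congr 3
  ring

theorem exists_norm_mul_radD_le (hn : 1 ≤ n) {q : ℝ} (hq : 0 < q) :
    ∃ C : ℝ, 0 ≤ C ∧ ∀ g f : En n → ℂ, DifferentiableOn ℂ g (Bn n) → DifferentiableOn ℂ f (Bn n) →
      hNorm n q (J g f) < ⊤ → ∀ a ∈ Bn n,
      ‖f a‖ * ‖radD g a‖ ≤ C * (1 - ‖a‖) ^ (-(n / q) - 1) * (hNorm n q (J g f)).toReal := by
  obtain ⟨C, hC, hgrow⟩ := exists_norm_le_hNorm hn hq
  refine ⟨C * 2 ^ (n / q + 1), by positivity, fun g f hg hf hJ a ha => ?_⟩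
  have ha1 : ‖a‖ < 1 := by simpa [Bn] using ha
  have hx : 0 < 1 - ‖a‖ := by linarith
  set ρ := (1 - ‖a‖) / 2 with hρ
  have hρ0 : 0 < ρ := by positivity
  have hnear : ∀ l ∈ closedBall (1 : ℂ) ρ, ‖l • a‖ ≤ 1 - ρ := by
    intro l hl
    rw [mem_closedBall, dist_eq_norm] at hl
    have h1 : ‖l‖ ≤ 1 + ρ := by
      have := norm_sub_norm_le l 1
      rw [norm_one] at this
      linarith
    rw [norm_smul]
    calc ‖l‖ * ‖a‖ ≤ (1 + ρ) * ‖a‖ := by gcongr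
      _ ≤ 1 - ρ := by nlinarith
  have hmem : ∀ l ∈ closedBall (1 : ℂ) ρ, l • a ∈ Bn n := fun l hl => by
    have := hnear l hl
    have h2 : ‖l • a‖ < 1 := by linarith
    simpa [Bn] using h2
  have hd : DifferentiableOn ℂ (fun l : ℂ => J g f (l • a)) (closedBall 1 ρ) :=
    (differentiableOn_J hg hf).comp (by fun_prop) hmem
  have hcauchy := Complex.norm_deriv_le_of_forall_mem_sphere_norm_le hρ0
    (C := C * ρ ^ (-(n / q)) * (hNorm n q (J g f)).toReal) (hd.diffContOnCl_ball subset_rfl)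
    fun l hl => by
      have hl' := sphere_subset_closedBall hl
      refine (hgrow _ ⟨differentiableOn_J hg hf, hJ⟩ _ (hmem l hl')).trans ?_
      have h1 := hnear l hl'
      gcongr C * ?_ * _
      exact Real.rpow_le_rpow_of_nonpos hρ0 (by linarith) (neg_nonpos.2 (by positivity))
  rw [deriv_J hg hf ha, norm_mul] at hcauchy
  refine hcauchy.trans_eq ?_
  have h1 : ρ ^ (-(n / q)) / ρ = 2 ^ (n / q + 1) * (1 - ‖a‖) ^ (-(n / q) - 1) := by
    rw [← Real.rpow_sub_one hρ0.ne', hρ, Real.div_rpow hx.le (by norm_num),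
      show n / q + 1 = -(-(n / q) - 1) by ring, Real.rpow_neg (by norm_num : (0 : ℝ) ≤ 2)]
    field_simp
  calc _ = C * (ρ ^ (-(n / q)) / ρ) * (hNorm n q (J g f)).toReal := by ring
    _ = _ := by rw [h1]; ring

theorem exists_radD_bound (hn : 1 ≤ n) {p q : ℝ} (hp : 0 < p) (hq : 0 < q)
    {g : En n → ℂ} (hg : DifferentiableOn ℂ g (Bn n)) {C₀ : ℝ≥0∞} (hC₀ : C₀ < ⊤)
    (hbdd : ∀ f, MemHp n p f → hNorm n q (J g f) ≤ C₀ * hNorm n p f) :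
    ∃ K : ℝ, ∀ a ∈ Bn n, 1 / 2 ≤ ‖a‖ → ‖radD g a‖ ≤ K * (1 - ‖a‖) ^ (n * (1 / p - 1 / q) - 1) := by
  obtain ⟨N, hN⟩ := exists_nat_gt (2 * n / p)
  rw [div_lt_iff₀ hp] at hN
  obtain ⟨K₁, hK₁, hkern⟩ := exists_hNorm_kern_bound hn hp hN
  obtain ⟨C, hC, hrad⟩ := exists_norm_mul_radD_le hn hq
  refine ⟨2 ^ N * C * C₀.toReal * K₁.toReal ^ (1 / p), fun a ha ha2 => ?_⟩
  have ha1 : ‖a‖ < 1 := by simpa [Bn] using ha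
  obtain ⟨u, hu, hau⟩ := exists_unit_smul_eq hn a
  set ε := 1 - ‖a‖ with hε
  have hε0 : 0 < ε := by linarith
  have hk := hkern u hu ε ⟨hε0, by linarith⟩
  rw [show (1 - ε) • u = a by rw [hε, sub_sub_cancel, ← hau]] at hk
  have hfin : hNorm n p (kern N a) < ⊤ := by
    rw [← ENNReal.rpow_lt_top_iff_of_pos hp]
    exact hk.trans_lt (ENNReal.mul_lt_top ENNReal.ofReal_lt_top hK₁.lt_top)
  have hmem : MemHp n p (kern N a) := ⟨differentiableOn_kern N ha1, hfin⟩
  have hb := hbdd _ hmem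
  have hbt : C₀ * hNorm n p (kern N a) < ⊤ := ENNReal.mul_lt_top hC₀ hfin
  have h1 := hrad g _ hg hmem.1 (hb.trans_lt hbt) a ha
  have h2 := ENNReal.toReal_mono hbt.ne hb
  rw [ENNReal.toReal_mul] at h2
  have h3 : (hNorm n p (kern N a)).toReal ≤ ε ^ (n / p - N) * K₁.toReal ^ (1 / p) := by
    have h4 := ENNReal.toReal_mono (ENNReal.mul_ne_top ENNReal.ofReal_ne_top hK₁) hk
    rw [ENNReal.toReal_mul, ← ENNReal.toReal_rpow, ENNReal.toReal_ofReal (by positivity)] at h4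
    have h5 := Real.rpow_le_rpow (by positivity) h4 (one_div_nonneg.2 hp.le)
    rw [← Real.rpow_mul ENNReal.toReal_nonneg, mul_one_div_cancel hp.ne', Real.rpow_one,
      Real.mul_rpow (by positivity) (by positivity), ← Real.rpow_mul hε0.le] at h5
    refine h5.trans_eq ?_
    congr 2
    field_simp
  have h4 : (2 ^ N * ε ^ N)⁻¹ ≤ ‖kern N a a‖ := by
    rw [kern, norm_inv, norm_pow, ← mul_pow]
    have h5 : (1 - inner ℂ a a : ℂ) = ((1 - ‖a‖ ^ 2 : ℝ) : ℂ) := by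
      rw [inner_self_eq_norm_sq_to_K]
      simp
    have h6 : 0 < 1 - ‖a‖ ^ 2 := by nlinarith [norm_nonneg a]
    rw [h5, Complex.norm_real, Real.norm_of_nonneg h6.le]
    gcongr
    nlinarith [norm_nonneg a]
  have h5 : ‖radD g a‖ ≤ (2 ^ N * ε ^ N) * (‖kern N a a‖ * ‖radD g a‖) := by
    rw [← mul_assoc]
    refine le_mul_of_one_le_left (norm_nonneg _) ?_
    rw [← inv_le_iff_one_le_mul₀' (by positivity)]
    exact h4
  calc ‖radD g a‖ ≤ (2 ^ N * ε ^ N) * (C * ε ^ (-(n / q) - 1) *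
        (C₀.toReal * (ε ^ (n / p - N) * K₁.toReal ^ (1 / p)))) := by
        refine h5.trans (mul_le_mul_of_nonneg_left (h1.trans ?_) (by positivity))
        exact mul_le_mul_of_nonneg_left
          (h2.trans (mul_le_mul_of_nonneg_left h3 ENNReal.toReal_nonneg)) (by positivity)
    _ = 2 ^ N * C * C₀.toReal * K₁.toReal ^ (1 / p) *
        (ε ^ (N : ℝ) * ε ^ (-(n / q) - 1) * ε ^ (n / p - N)) := by
        rw [Real.rpow_natCast]
        ring
    _ = _ := by
        rw [← Real.rpow_add hε0, ← Real.rpow_add hε0]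
        congr 2
        ring

theorem radD_eq_zero_of_bound (hn : 1 ≤ n) {g : En n → ℂ} (hg : DifferentiableOn ℂ g (Bn n))
    {K β : ℝ} (hβ : 0 < β)
    (hb : ∀ a ∈ Bn n, 1 / 2 ≤ ‖a‖ → ‖radD g a‖ ≤ K * (1 - ‖a‖) ^ β) {z : En n} (hz : z ∈ Bn n) :
    radD g z = 0 := by
  have hz1 : ‖z‖ < 1 := by simpa [Bn] using hz
  have : Nontrivial (En n) :=
    Module.nontrivial_of_finrank_pos (R := ℝ) (by rw [finrank_real_En]; omega)
  have hle : ∀ᶠ r in 𝓝[<] (1 : ℝ), ‖radD g z‖ ≤ K * (1 - r) ^ β := by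
    filter_upwards [Ioo_mem_nhdsLT (show max (1 / 2) ‖z‖ < 1 from max_lt (by norm_num) hz1)]
      with r hr
    have hr2 := (le_max_left _ _).trans_lt hr.1
    have hrz := (le_max_right _ _).trans_lt hr.1
    have hd : DiffContOnCl ℂ (radD g) (ball 0 r) :=
      ((differentiableOn_radD hg).mono (closedBall_subset_ball hr.2)).diffContOnCl_ball subset_rfl
    refine Complex.norm_le_of_forall_mem_frontier_norm_le isBounded_ball hd (fun w hw => ?_)
      (subset_closure (by simpa using hrz))
    have hw1 : ‖w‖ = r := by
      rw [frontier_ball _ (by linarith)] at hw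
      simpa using hw
    rw [← hw1]
    exact hb w (by simpa [Bn, hw1] using hr.2) (by rw [hw1]; exact hr2.le)
  have hlim : Tendsto (fun r : ℝ => K * (1 - r) ^ β) (𝓝[<] 1) (𝓝 0) := by
    have hc : Continuous fun r : ℝ => K * (1 - r) ^ β :=
      continuous_const.mul ((continuous_const.sub continuous_id).rpow_const fun _ => .inr hβ.le)
    have := (hc.tendsto 1).mono_left (nhdsWithin_le_nhds (s := Iio 1))
    simpa [Real.zero_rpow hβ.ne'] using this
  exact norm_le_zero_iff.1 (ge_of_tendsto hlim hle)

theorem eq_apply_zero_of_radD_eq_zero {g : En n → ℂ} (hg : DifferentiableOn ℂ g (Bn n))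
    (h0 : ∀ z ∈ Bn n, radD g z = 0) {z : En n} (hz : z ∈ Bn n) : g z = g 0 := by
  have hz1 : ‖z‖ < 1 := by simpa [Bn] using hz
  have hmem : ∀ t ∈ Icc (0 : ℝ) 1, t • z ∈ Bn n := fun t ht => by
    have : ‖t • z‖ < 1 := by
      rw [norm_smul, Real.norm_of_nonneg ht.1]
      nlinarith [norm_nonneg z, ht.1, ht.2]
    simpa [Bn] using this
  have hcont : ContinuousOn (fun t : ℝ => g (t • z)) (Icc 0 1) :=
    hg.continuousOn.comp (by fun_prop) hmem
  have hderiv : ∀ t ∈ Ioo (0 : ℝ) 1, HasDerivAt (fun t : ℝ => g (t • z)) 0 t := by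
    intro t ht
    have hm := hmem t (Ioo_subset_Icc_self ht)
    have h1 := (hg.differentiableAt (isOpen_ball.mem_nhds hm)).hasFDerivAt.restrictScalars ℝ
    have h2 : HasDerivAt (fun t : ℝ => t • z) z t := by
      simpa using (hasDerivAt_id t).smul_const z
    have h3 := h1.comp_hasDerivAt t h2
    have h4 := h0 _ hm
    rw [radD, ContinuousLinearMap.map_smul_of_tower, smul_eq_zero_iff_right ht.1.ne'] at h4
    rw [ContinuousLinearMap.coe_restrictScalars', h4] at h3
    exact h3
  have := intervalIntegral.integral_eq_sub_of_hasDerivAt_of_le zero_le_one hcont hderiv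
    intervalIntegrable_const
  simp only [intervalIntegral.integral_zero, one_smul, zero_smul] at this
  exact sub_eq_zero.1 this.symm

theorem radD_eq_zero_of_const {g : En n → ℂ} (hc : ∀ z ∈ Bn n, g z = g 0) {z : En n}
    (hz : z ∈ Bn n) : radD g z = 0 := by
  have h : g =ᶠ[𝓝 z] fun _ => g 0 := by
    filter_upwards [isOpen_ball.mem_nhds hz] with w hw using hc w hw
  rw [radD, h.fderiv_eq]
  simp

theorem J_eq_zero_of_const {g : En n → ℂ} (hc : ∀ z ∈ Bn n, g z = g 0) (f : En n → ℂ) {z : En n}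
    (hz : z ∈ Bn n) : J g f z = 0 := by
  have hz1 : ‖z‖ < 1 := by simpa [Bn] using hz
  refine setIntegral_eq_zero_of_forall_eq_zero fun t ht => ?_
  rw [radD_eq_zero_of_const hc (smul_mem_Bn hz1 ht), mul_zero, zero_div]

theorem hNorm_eq_zero_of_eqOn_zero {q : ℝ} (hq : 0 < q) {h : En n → ℂ}
    (hh : ∀ z ∈ Bn n, h z = 0) : hNorm n q h = 0 := by
  rw [hNorm, ENNReal.rpow_eq_zero_iff_of_pos (by positivity)]
  simp only [ENNReal.iSup_eq_zero]
  intro r hr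
  refine lintegral_eq_zero_of_ae_eq_zero ?_
  filter_upwards [ae_norm_eq_one_sigmaS] with ζ hζ
  have : r • ζ ∈ Bn n := by
    simpa [Bn, norm_smul, hζ, abs_of_pos hr.1] using hr.2
  simp [hh _ this, hq]

end Volterra

/-- For `0 < p < q < ∞` with `n(1/p - 1/q) > 1` and `g` holomorphic on
`B_n`, the operator `J_g : H^p → H^q` is bounded iff `g` is constant, in which case
`J_g ≡ 0` on `B_n`. -/
theorem stmt2 (n : ℕ) (hn : 1 ≤ n) (p q : ℝ) (hp : 0 < p) (hpq : p < q)
    (hα : 1 < (n : ℝ) * (1 / p - 1 / q))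
    (g : En n → ℂ) (hg : DifferentiableOn ℂ g (Bn n)) :
    ((∃ C : ℝ≥0∞, 0 < C ∧ C < ⊤ ∧
        ∀ f, MemHp n p f → hNorm n q (J g f) ≤ C * hNorm n p f) ↔
      ∀ z ∈ Bn n, g z = g 0) ∧
    ((∀ z ∈ Bn n, g z = g 0) → ∀ f : En n → ℂ, ∀ z ∈ Bn n, J g f z = 0) := by
  have hq : 0 < q := hp.trans hpq
  refine ⟨⟨fun ⟨C, _, hC, hbdd⟩ z hz => ?_, fun hc => ⟨1, one_pos, ENNReal.one_lt_top,
    fun f _ => ?_⟩⟩, fun hc f z hz => J_eq_zero_of_const hc f hz⟩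
  · obtain ⟨K, hK⟩ := exists_radD_bound hn hp hq hg hC hbdd
    exact eq_apply_zero_of_radD_eq_zero hg
      (fun w hw => radD_eq_zero_of_bound hn hg (sub_pos.2 hα) hK hw) hz
  · rw [hNorm_eq_zero_of_eqOn_zero hq fun z hz => J_eq_zero_of_const hc f hz]
    exact zero_le

end
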